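/- arXiv:2306.01882 — 6 statements merged into one kernel-verified Lean document; each statement's English description precedes it below -/
import Mathlib

section
/- In the subconstituent algebra of the non-binary Johnson scheme J_r(k,n), the pair (A*_{01}, A_{01}) satisfies the Dolan–Grady-type relation [A*_{01}, [A*_{01}, [A*_{01}, A_{01}]]] = (n(n−1)/(k(n−k)))²·[A*_{01}, A_{01}]. -/
/-- The vertex set of the non-binary Johnson scheme `J_r(k, n)`: words of length `n`
over the alphabet `{0, 1, …, r-1}` of weight `k` (number of nonzero letters). -/
abbrev JohnsonVertex (r n k : ℕ) :=
  {x : Fin n → Fin r // (Finset.univ.filter fun i => (x i).val ≠ 0).card = k}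

/-- Number of equal nonzero components `e(x, y)`. -/
def ecnt {r n : ℕ} (x y : Fin n → Fin r) : ℕ :=
  (Finset.univ.filter fun i => x i = y i ∧ (x i).val ≠ 0).card

/-- Number of common nonzeros `c(x, y)`. -/
def ccnt {r n : ℕ} (x y : Fin n → Fin r) : ℕ :=
  (Finset.univ.filter fun i => (x i).val ≠ 0 ∧ (y i).val ≠ 0).card

/-- Adjacency matrix `A_{ij}` of the non-binary Johnson scheme `J_r(k, n)`,
with the convention `A_{ij} := 0` whenever `i < 0` or `j < 0`. -/
def Amat (r n k : ℕ) (i j : ℤ) : Matrix (JohnsonVertex r n k) (JohnsonVertex r n k) ℚ :=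
  if i < 0 ∨ j < 0 then 0 else
    Matrix.of fun x y =>
      if (ecnt x.1 y.1 : ℤ) = (k : ℤ) - i - j ∧ (ccnt x.1 y.1 : ℤ) = (k : ℤ) - j then 1 else 0

/-- `θ*(a, b) = (n/k)((r-2)(k-b) - a(r-1))`. -/
noncomputable def thetaStar (r n k : ℕ) (a b : ℚ) : ℚ :=
  ((n : ℚ) / k) * (((r : ℚ) - 2) * ((k : ℚ) - b) - a * ((r : ℚ) - 1))

/-- `μ*(a, b) = (n-1)(1 - n b / (k(n-k)))`. -/
noncomputable def muStar (n k : ℕ) (b : ℚ) : ℚ :=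
  ((n : ℚ) - 1) * (1 - (n : ℚ) * b / ((k : ℚ) * ((n : ℚ) - k)))

/-- Dual adjacency matrix `A*_{10}` of the non-binary Johnson scheme with respect to `x0`. -/
noncomputable def Astar10 (r n k : ℕ) (x0 : JohnsonVertex r n k) :
    Matrix (JohnsonVertex r n k) (JohnsonVertex r n k) ℚ :=
  Matrix.diagonal fun y =>
    thetaStar r n k ((ccnt x0.1 y.1 : ℚ) - (ecnt x0.1 y.1 : ℚ)) ((k : ℚ) - (ccnt x0.1 y.1 : ℚ))

/-- Dual adjacency matrix `A*_{01}` of the non-binary Johnson scheme with respect to `x0`. -/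
noncomputable def Astar01 (r n k : ℕ) (x0 : JohnsonVertex r n k) :
    Matrix (JohnsonVertex r n k) (JohnsonVertex r n k) ℚ :=
  Matrix.diagonal fun y => muStar n k ((k : ℚ) - (ccnt x0.1 y.1 : ℚ))

/-- Matrix commutator. -/
def mcomm {m : Type*} [Fintype m] (A B : Matrix m m ℚ) : Matrix m m ℚ := A * B - B * A

theorem mcomm_diagonal_apply {m : Type*} [Fintype m] [DecidableEq m] (d : m → ℚ)
    (B : Matrix m m ℚ) (y z : m) :
    mcomm (Matrix.diagonal d) B y z = (d y - d z) * B y z := by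
  simp only [mcomm, Matrix.sub_apply, Matrix.diagonal_mul, Matrix.mul_diagonal]
  ring

theorem ccnt_comm {r n : ℕ} (x y : Fin n → Fin r) : ccnt x y = ccnt y x := by
  simp only [ccnt, and_comm]

/-- Triangle-type inequality for supports: `|X ∩ Y| + |Y ∩ Z| ≤ |X ∩ Z| + |Y|`. -/
theorem ccnt_add_ccnt_le {r n : ℕ} (x y z : Fin n → Fin r) :
    ccnt x y + ccnt y z ≤ ccnt x z + (Finset.univ.filter fun i => (y i).val ≠ 0).card := by
  unfold ccnt
  rw [← Finset.card_union_add_card_inter, add_comm]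
  refine Nat.add_le_add (Finset.card_le_card fun i => ?_) (Finset.card_le_card fun i => ?_) <;>
    simp only [Finset.mem_union, Finset.mem_inter, Finset.mem_filter, Finset.mem_univ,
      true_and] <;>
    tauto

/-- Neighbours in `A_{01}` have supports meeting that of `x0` in nearly equally many places. -/
theorem ccnt_sub_cube_eq {r n k : ℕ} (x0 y z : JohnsonVertex r n k)
    (h : (ccnt y.1 z.1 : ℤ) = k - 1) :
    ((ccnt x0.1 y.1 : ℚ) - ccnt x0.1 z.1) ^ 3 = ccnt x0.1 y.1 - ccnt x0.1 z.1 := by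
  have hy := ccnt_add_ccnt_le x0.1 y.1 z.1
  have hz := ccnt_add_ccnt_le x0.1 z.1 y.1
  rw [y.2] at hy
  rw [z.2, ccnt_comm z.1] at hz
  have hd : (ccnt x0.1 y.1 : ℤ) - ccnt x0.1 z.1 = -1 ∨ (ccnt x0.1 y.1 : ℤ) - ccnt x0.1 z.1 = 0 ∨
      (ccnt x0.1 y.1 : ℤ) - ccnt x0.1 z.1 = 1 := by omega
  have hcube : ((ccnt x0.1 y.1 : ℤ) - ccnt x0.1 z.1) ^ 3 = ccnt x0.1 y.1 - ccnt x0.1 z.1 := by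
    rcases hd with hd | hd | hd <;> rw [hd] <;> norm_num
  exact_mod_cast hcube

theorem muStar_sub_muStar (n k : ℕ) (b c : ℚ) :
    muStar n k (k - b) - muStar n k (k - c) =
      (n : ℚ) * ((n : ℚ) - 1) / ((k : ℚ) * ((n : ℚ) - k)) * (b - c) := by
  unfold muStar
  ring

/-- Dolan–Grady-type relation for the pair `(A*_{01}, A_{01})` in the subconstituent algebra
of the non-binary Johnson scheme. -/
theorem johnson_dolan_grady_01 (r n k : ℕ) (hr : 3 ≤ r) (hk1 : 1 ≤ k) (hkn : k + 1 ≤ n)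
    (x0 : JohnsonVertex r n k) :
    mcomm (Astar01 r n k x0) (mcomm (Astar01 r n k x0)
        (mcomm (Astar01 r n k x0) (Amat r n k 0 1)))
  = (((n : ℚ) * ((n : ℚ) - 1) / ((k : ℚ) * ((n : ℚ) - k))) ^ 2)
      • mcomm (Astar01 r n k x0) (Amat r n k 0 1) := by
  ext y z
  simp only [Astar01, mcomm_diagonal_apply, Matrix.smul_apply, smul_eq_mul, muStar_sub_muStar]
  by_cases h : (ccnt y.1 z.1 : ℤ) = k - 1
  · linear_combination ((n : ℚ) * ((n : ℚ) - 1) / ((k : ℚ) * ((n : ℚ) - k))) ^ 3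
      * Amat r n k 0 1 y z * ccnt_sub_cube_eq x0 y z h
  · simp [Amat, h]
end

section
/- For the non-binary Johnson scheme J_r(k,n) with n ≥ 2k−1, the elements A_{01}, A*_{01}, A_{10} satisfy the (centrally extended) tridiagonal relation [A_{01}, 2·A_{01}A*_{01}A_{01} − (A_{01}²A*_{01} + A*_{01}A_{01}²) + 2(r−1)(A_{01}A*_{01} + A*_{01}A_{01}) + (c₁·I + c₂·A_{10} + A_{10}²)·A*_{01}] = 0, where c₁ = n(n+2)(r−1)² + k²r² − 2k(r−1)(r(n+1)−2) and c₂ = 2(kr − (n−1)(r−1)). -/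
section SiteOperators

variable {ι α : Type*} [Fintype ι] [DecidableEq ι] [DecidableEq α]

/-- The operator on words that applies the single-letter matrix `L` at position `i`. -/
def siteOp (i : ι) : Matrix α α ℚ →ₗ[ℚ] Matrix (ι → α) (ι → α) ℚ where
  toFun L := Matrix.of fun x y => if ∀ l, l ≠ i → x l = y l then L (x i) (y i) else 0
  map_add' L L' := by
    ext x y
    simp only [Matrix.of_apply, Matrix.add_apply]
    split_ifs <;> simp
  map_smul' c L := by
    ext x y
    simp only [Matrix.of_apply, Matrix.smul_apply, RingHom.id_apply]
    split_ifs <;> simp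

lemma siteOp_apply (i : ι) (L : Matrix α α ℚ) (x y : ι → α) :
    siteOp i L x y = if ∀ l, l ≠ i → x l = y l then L (x i) (y i) else 0 := rfl

lemma siteOp_diagonal (i : ι) (d : α → ℚ) :
    siteOp i (Matrix.diagonal d) = Matrix.diagonal fun x : ι → α => d (x i) := by
  ext x y
  rw [siteOp_apply]
  by_cases hxy : x = y
  · subst hxy
    simp
  · rw [Matrix.diagonal_apply_ne _ hxy]
    split_ifs with h
    · apply Matrix.diagonal_apply_ne
      intro hi
      apply hxy
      funext l
      by_cases hl : l = i
      · rw [hl, hi]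
      · exact h l hl
    · rfl

lemma siteOp_one (i : ι) : siteOp i (1 : Matrix α α ℚ) = 1 := by
  rw [← Matrix.diagonal_one, siteOp_diagonal, ← Matrix.diagonal_one]

/-- The sum over all positions `i` of the single-letter matrix `L i` applied at `i`. -/
def siteSum : (ι → Matrix α α ℚ) →ₗ[ℚ] Matrix (ι → α) (ι → α) ℚ :=
  ∑ i, (siteOp i).comp (LinearMap.proj i)

lemma siteSum_apply (L : ι → Matrix α α ℚ) : siteSum L = ∑ i, siteOp i (L i) := by
  simp [siteSum]

lemma siteSum_one : siteSum (fun _ : ι => (1 : Matrix α α ℚ)) =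
    (Fintype.card ι : ℚ) • (1 : Matrix (ι → α) (ι → α) ℚ) := by
  rw [siteSum_apply]
  simp only [siteOp_one, Finset.sum_const, Finset.card_univ]
  rw [Nat.cast_smul_eq_nsmul]

variable [Fintype α]

lemma siteOp_mul_siteOp_same (i : ι) (L L' : Matrix α α ℚ) :
    siteOp i L * siteOp i L' = siteOp i (L * L') := by
  ext x y
  rw [Matrix.mul_apply, siteOp_apply, Matrix.mul_apply]
  have hvanish : ∀ z, z ∉ Set.range (Function.update x i) →
      siteOp i L x z * siteOp i L' z y = 0 := by
    intro z hz
    rw [siteOp_apply, if_neg, zero_mul]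
    refine fun h => hz ⟨z i, funext fun l => ?_⟩
    by_cases hl : l = i
    · subst hl
      simp
    · simpa [hl] using h l hl
  rw [← Fintype.sum_of_injective (Function.update x i) (Function.update_injective x i) _ _
    hvanish fun _ => rfl]
  have h1 : ∀ a l, l ≠ i → x l = Function.update x i a l := fun a l hl => by simp [hl]
  have h2 : ∀ a, (∀ l, l ≠ i → Function.update x i a l = y l) ↔ ∀ l, l ≠ i → x l = y l :=
    fun a => forall₂_congr fun l hl => by simp [hl]
  simp only [siteOp_apply, if_pos (h1 _), Function.update_self, h2]
  split_ifs <;> simp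

lemma siteOp_mul_siteOp_apply {i j : ι} (hij : i ≠ j) (L L' : Matrix α α ℚ) (x y : ι → α) :
    (siteOp i L * siteOp j L') x y =
      if ∀ l, l ≠ i → l ≠ j → x l = y l then L (x i) (y i) * L' (x j) (y j) else 0 := by
  rw [Matrix.mul_apply, Finset.sum_eq_single (Function.update x i (y i))]
  · have h1 : ∀ l, l ≠ i → x l = Function.update x i (y i) l := fun l hl => by simp [hl]
    have h2 : (∀ l, l ≠ j → Function.update x i (y i) l = y l) ↔
        ∀ l, l ≠ i → l ≠ j → x l = y l := by
      refine forall_congr' fun l => ?_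
      by_cases hl : l = i
      · subst hl
        simp
      · simp [hl]
    rw [siteOp_apply, siteOp_apply, if_pos h1, if_congr h2 rfl rfl]
    simp [hij.symm]
  · intro z _ hz
    rw [siteOp_apply, siteOp_apply]
    split_ifs with h1 h2
    · exfalso
      apply hz
      funext l
      by_cases hl : l = i
      · subst hl
        simpa using h2 l hij
      · simpa [hl] using (h1 l hl).symm
    all_goals simp
  · simp

lemma siteOp_commute {i j : ι} (hij : i ≠ j) (L L' : Matrix α α ℚ) :
    siteOp i L * siteOp j L' = siteOp j L' * siteOp i L := by
  ext x y
  rw [siteOp_mul_siteOp_apply hij, siteOp_mul_siteOp_apply hij.symm, mul_comm (L' _ _)]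
  exact if_congr (forall_congr' fun l => ⟨fun h a b => h b a, fun h a b => h b a⟩) rfl rfl

lemma siteSum_commutator (L L' : ι → Matrix α α ℚ) :
    siteSum L * siteSum L' - siteSum L' * siteSum L =
      siteSum fun i => L i * L' i - L' i * L i := by
  simp only [siteSum_apply, Finset.sum_mul_sum]
  rw [Finset.sum_comm (f := fun i j => siteOp i (L' i) * siteOp j (L j)),
    ← Finset.sum_sub_distrib]
  refine Finset.sum_congr rfl fun i _ => ?_
  rw [← Finset.sum_sub_distrib, Finset.sum_eq_single i]
  · rw [siteOp_mul_siteOp_same, siteOp_mul_siteOp_same, map_sub]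
  · intro j _ hj
    rw [siteOp_commute hj.symm, sub_self]
  · simp

end SiteOperators

section Letters

variable (q : ℕ)

/-- The matrix sending the letter `0` to the sum of the nonzero letters. -/
def letterRaise : Matrix (Fin (q + 1)) (Fin (q + 1)) ℚ :=
  Matrix.of fun a b => if a.val ≠ 0 ∧ b.val = 0 then 1 else 0

/-- The matrix sending every nonzero letter to the letter `0`. -/
def letterLower : Matrix (Fin (q + 1)) (Fin (q + 1)) ℚ :=
  Matrix.of fun a b => if a.val = 0 ∧ b.val ≠ 0 then 1 else 0

/-- The projection onto the nonzero letters. -/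
def letterOcc : Matrix (Fin (q + 1)) (Fin (q + 1)) ℚ :=
  Matrix.diagonal fun a => if a.val ≠ 0 then 1 else 0

lemma letterRaise_mul_letterRaise : letterRaise q * letterRaise q = 0 := by
  ext a b
  simp [letterRaise, Matrix.mul_apply, Fin.sum_univ_succ]

lemma letterLower_mul_letterLower : letterLower q * letterLower q = 0 := by
  ext a b
  simp [letterLower, Matrix.mul_apply, Fin.sum_univ_succ]

lemma letterRaise_mul_letterLower_apply (a b : Fin (q + 1)) :
    (letterRaise q * letterLower q) a b = if a.val ≠ 0 ∧ b.val ≠ 0 then 1 else 0 := by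
  by_cases ha : a = 0 <;> by_cases hb : b = 0 <;>
    simp [letterRaise, letterLower, Matrix.mul_apply, ha, hb]

lemma letterLower_mul_letterRaise :
    letterLower q * letterRaise q = (q : ℚ) • (1 - letterOcc q) := by
  ext a b
  refine Fin.cases ?_ (fun a => ?_) a <;> refine Fin.cases ?_ (fun b => ?_) b <;>
    simp [letterRaise, letterLower, letterOcc, Matrix.mul_apply, Fin.sum_univ_succ,
      Matrix.one_apply, Matrix.diagonal_apply, (Fin.succ_ne_zero _).symm]

lemma letterOcc_mul_letterRaise : letterOcc q * letterRaise q = letterRaise q := by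
  ext a b
  by_cases ha : a = 0 <;> simp [letterRaise, letterOcc, ha]

lemma letterRaise_mul_letterOcc : letterRaise q * letterOcc q = 0 := by
  ext a b
  simp [letterRaise, letterOcc]
  tauto

lemma letterOcc_mul_letterLower : letterOcc q * letterLower q = 0 := by
  ext a b
  simp [letterLower, letterOcc]
  tauto

lemma letterLower_mul_letterOcc : letterLower q * letterOcc q = letterLower q := by
  ext a b
  by_cases hb : b = 0 <;> simp [letterLower, letterOcc, hb]

lemma letterRaise_lower_raise :
    letterRaise q * letterLower q * letterRaise q = (q : ℚ) • letterRaise q := by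
  rw [mul_assoc, letterLower_mul_letterRaise, mul_smul_comm, mul_sub, mul_one,
    letterRaise_mul_letterOcc, sub_zero]

lemma letterLower_raise_lower :
    letterLower q * letterRaise q * letterLower q = (q : ℚ) • letterLower q := by
  rw [letterLower_mul_letterRaise, smul_mul_assoc, sub_mul, one_mul,
    letterOcc_mul_letterLower, sub_zero]

end Letters

/-- If `e, f, h` span a copy of `sl₂` and `c` is the weight-zero component of a vector operator
with companions `e', f', h'`, then `c` satisfies a cubic relation with respect to `e * f`. -/
lemma cubic_relation_of_vector_operator {R : Type*} [Ring R] [Algebra ℚ R] (q : ℚ)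
    {e f h c e' f' h' : R}
    (hfe : f * e - e * f = h) (he : h * e - e * h = (-2 * q) • e)
    (hf : h * f - f * h = (2 * q) • f)
    (hce : c * e - e * c = e') (hcf : c * f - f * c = -f')
    (hee' : e' * e - e * e' = 0) (hff' : f' * f - f * f' = 0)
    (hfe' : f * e' - e' * f = h') (hf'e : f' * e - e * f' = h')
    (hhe' : h * e' - e' * h = (-2 * q) • e')
    (hh'e : h' * e - e * h' = (-2 * q) • e') (hh'f : h' * f - f * h' = (2 * q) • f')
    {m y w : R} (hm : m = e * f) (hy : y = m * c - c * m) (hw : w = m * y - y * m) :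
    m * w - w * m = (2 * q) • (m * m * c - c * (m * m)) + (h * h + (2 * q) • h) * y := by
  have hy' : y = e * f' - e' * f := by
    rw [hy, hm]
    linear_combination (norm := noncomm_ring) -hce * f - e * hcf
  have hehf : h * m = m * h := by
    rw [hm]
    linear_combination
      (norm := (simp only [mul_sub, sub_mul, smul_mul_assoc, mul_smul_comm, mul_assoc]; module))
      he * f + e * hf
  have hw1 : w = e * h * f' + e' * h * f - (2 : ℚ) • (e * h' * f) := by
    rw [hw, hy', hm]
    linear_combination
      (norm := (simp only [mul_sub, sub_mul, mul_assoc, mul_zero,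
        zero_mul]; module))
      e * hfe * f' - e * hfe' * f - e * hf'e * f + e' * hfe * f - e * e * hff' + hee' * f * f
  have hw2 : w = h * (e * f' + e' * f) + (2 * q) • y - (2 : ℚ) • (h' * m) := by
    rw [hw1, hy', hm]
    linear_combination
      (norm := (simp only [sub_mul, mul_add, smul_mul_assoc,
        mul_assoc]; module))
      -he * f' - hhe' * f + (2 : ℚ) • (hh'e * f)
  have hmu : m * (e * f' + e' * f) - (e * f' + e' * f) * m = h * y + (2 * q) • y := by
    rw [hy', hm]
    linear_combination
      (norm := (simp only [mul_sub, sub_mul, mul_add, add_mul, smul_mul_assoc,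
        mul_assoc, mul_zero, zero_mul]; module))
      e * hfe * f' + e * hfe' * f - e * hf'e * f - e' * hfe * f - e * e * hff' - hee' * f * f
        - he * f' + hhe' * f
  have hmh' : m * h' - h' * m = (-2 * q) • y := by
    rw [hy', hm]
    linear_combination
      (norm := (simp only [mul_sub, sub_mul, smul_mul_assoc, mul_smul_comm,
        mul_assoc]; module))
      -hh'e * f - e * hh'f
  have hsq : m * m * c - c * (m * m) = w + (2 : ℚ) • (y * m) := by
    rw [hw, hy]
    simp only [mul_sub, sub_mul, mul_assoc]
    module
  have key : m * w - w * m = h * (m * (e * f' + e' * f) - (e * f' + e' * f) * m)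
      + (2 * q) • w - (2 : ℚ) • ((m * h' - h' * m) * m) := by
    conv_lhs => rw [hw2]
    rw [hw]
    linear_combination
      (norm := (simp only [mul_sub, sub_mul, mul_add, add_mul, smul_mul_assoc, mul_smul_comm,
        mul_assoc]; module))
      -hehf * (e * f' + e' * f)
  rw [key, hmu, hmh', hsq]
  simp only [mul_add, add_mul, smul_mul_assoc, mul_smul_comm, mul_assoc]
  module

section Combinatorics

variable {r n k : ℕ} {x y : Fin n → Fin r}

/-- The positions of the nonzero letters of a word. -/
def wordSupport (x : Fin n → Fin r) : Finset (Fin n) :=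
  Finset.univ.filter fun i => (x i).val ≠ 0

/-- The positions at which two words carry the same nonzero letter. -/
def wordAgree (x y : Fin n → Fin r) : Finset (Fin n) :=
  Finset.univ.filter fun i => x i = y i ∧ (x i).val ≠ 0

lemma mem_wordSupport {i : Fin n} : i ∈ wordSupport x ↔ (x i).val ≠ 0 := by
  simp [wordSupport]

lemma mem_wordAgree {i : Fin n} : i ∈ wordAgree x y ↔ x i = y i ∧ (x i).val ≠ 0 := by
  simp [wordAgree]

lemma ecnt_eq_card : ecnt x y = (wordAgree x y).card := rfl

lemma ccnt_eq_card : ccnt x y = (wordSupport x ∩ wordSupport y).card := by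
  rw [ccnt, wordSupport, wordSupport, Finset.filter_and]

lemma wordAgree_subset_inter : wordAgree x y ⊆ wordSupport x ∩ wordSupport y := by
  intro i hi
  rw [mem_wordAgree] at hi
  simp [mem_wordSupport, ← hi.1, hi.2]

lemma ext_of_val_eq_zero {a b : Fin r} (ha : a.val = 0) (hb : b.val = 0) : a = b :=
  Fin.ext (ha.trans hb.symm)

/-- Two words differ by replacing one nonzero letter by another one at the same position. -/
lemma exists_replacement_iff (hx : (wordSupport x).card = k) :
    (∃ i, (x i).val ≠ 0 ∧ (y i).val ≠ 0 ∧ x i ≠ y i ∧ ∀ l, l ≠ i → x l = y l) ↔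
      (wordSupport y).card = k ∧ ecnt x y + 1 = k ∧ ccnt x y = k := by
  rw [ecnt_eq_card, ccnt_eq_card]
  constructor
  · rintro ⟨i, hxi, hyi, hne, hl⟩
    have hs : wordSupport y = wordSupport x := by
      ext l
      rw [mem_wordSupport, mem_wordSupport]
      by_cases h : l = i
      · simp [h, hxi, hyi]
      · rw [hl l h]
    have he : wordAgree x y = (wordSupport x).erase i := by
      ext l
      rw [mem_wordAgree, Finset.mem_erase, mem_wordSupport]
      by_cases h : l = i
      · simp [h, hne]
      · simp [h, hl l h]
    rw [hs, he, Finset.inter_self]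
    exact ⟨hx, (Finset.card_erase_add_one (mem_wordSupport.2 hxi)).trans hx, hx⟩
  · rintro ⟨hy, he, hc⟩
    have hsx : wordSupport x ∩ wordSupport y = wordSupport x :=
      Finset.eq_of_subset_of_card_le Finset.inter_subset_left (by omega)
    have hsy : wordSupport x ∩ wordSupport y = wordSupport y :=
      Finset.eq_of_subset_of_card_le Finset.inter_subset_right (by omega)
    have hs : wordSupport x = wordSupport y := hsx.symm.trans hsy
    have hsub : wordAgree x y ⊆ wordSupport x :=
      wordAgree_subset_inter.trans Finset.inter_subset_left
    obtain ⟨i, hi⟩ := Finset.card_eq_one.1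
      (show (wordSupport x \ wordAgree x y).card = 1 by
        rw [Finset.card_sdiff_of_subset hsub]; omega)
    have hmem : ∀ l, l ∈ wordSupport x ∧ l ∉ wordAgree x y ↔ l = i := fun l => by
      rw [← Finset.mem_sdiff, hi, Finset.mem_singleton]
    obtain ⟨hi1, hi2⟩ := (hmem i).2 rfl
    refine ⟨i, mem_wordSupport.1 hi1, mem_wordSupport.1 (hs ▸ hi1), fun h => hi2
      (mem_wordAgree.2 ⟨h, mem_wordSupport.1 hi1⟩), fun l hl => ?_⟩
    by_cases hlx : l ∈ wordSupport x
    · by_contra h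
      exact hl ((hmem l).1 ⟨hlx, fun h' => h (mem_wordAgree.1 h').1⟩)
    · have hly : l ∉ wordSupport y := hs ▸ hlx
      rw [mem_wordSupport, not_not] at hlx hly
      exact ext_of_val_eq_zero hlx hly

/-- Two words differ by deleting a nonzero letter and inserting one at an empty position. -/
lemma exists_move_iff (hx : (wordSupport x).card = k) :
    (∃ i j, ((x i).val ≠ 0 ∧ (y i).val = 0 ∧ (x j).val = 0 ∧ (y j).val ≠ 0) ∧
        ∀ l, l ≠ i → l ≠ j → x l = y l) ↔
      (wordSupport y).card = k ∧ ecnt x y + 1 = k ∧ ccnt x y + 1 = k := by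
  rw [ecnt_eq_card, ccnt_eq_card]
  constructor
  · rintro ⟨i, j, ⟨hxi, hyi, hxj, hyj⟩, hl⟩
    have hij : j ≠ i := by
      rintro rfl
      exact hxi hxj
    have hi : i ∈ wordSupport x := mem_wordSupport.2 hxi
    have hj : j ∉ (wordSupport x).erase i := by
      simp [mem_wordSupport, hxj]
    have he : wordAgree x y = (wordSupport x).erase i := by
      ext l
      rw [mem_wordAgree, Finset.mem_erase, mem_wordSupport]
      by_cases h : l = i
      · subst h
        simp only [ne_eq, not_true_eq_false, false_and, iff_false, not_and]
        intro h _
        exact hxi (h ▸ hyi)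
      · by_cases h' : l = j
        · simp [h', hxj]
        · simp [h, hl l h h']
    have hs : wordSupport y = insert j ((wordSupport x).erase i) := by
      ext l
      rw [mem_wordSupport, Finset.mem_insert, Finset.mem_erase, mem_wordSupport]
      by_cases h : l = i
      · simp [h, hyi, hij.symm]
      · by_cases h' : l = j
        · simp [h', hyj]
        · simp [h, h', hl l h h']
    have hc : wordSupport x ∩ wordSupport y = (wordSupport x).erase i := by
      refine Finset.Subset.antisymm ?_ (he ▸ wordAgree_subset_inter)
      intro l hlm
      rw [Finset.mem_inter, mem_wordSupport, mem_wordSupport] at hlm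
      rw [Finset.mem_erase, mem_wordSupport]
      refine ⟨?_, hlm.1⟩
      rintro rfl
      exact hlm.2 hyi
    have hcard := (Finset.card_erase_add_one hi).trans hx
    rw [hc, he, hs, Finset.card_insert_of_notMem hj]
    exact ⟨hcard, hcard, hcard⟩
  · rintro ⟨hy, he, hc⟩
    have hagree : wordAgree x y = wordSupport x ∩ wordSupport y :=
      Finset.eq_of_subset_of_card_le wordAgree_subset_inter (by omega)
    obtain ⟨i, hi⟩ := Finset.card_eq_one.1
      (show (wordSupport x \ wordSupport y).card = 1 by
        have := Finset.card_sdiff_add_card_inter (wordSupport x) (wordSupport y)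
        omega)
    obtain ⟨j, hj⟩ := Finset.card_eq_one.1
      (show (wordSupport y \ wordSupport x).card = 1 by
        have := Finset.card_sdiff_add_card_inter (wordSupport y) (wordSupport x)
        rw [Finset.inter_comm] at this
        omega)
    have hi' : ∀ l, ((x l).val ≠ 0 ∧ (y l).val = 0) ↔ l = i := fun l => by
      simpa [mem_wordSupport] using Finset.ext_iff.1 hi l
    have hj' : ∀ l, ((y l).val ≠ 0 ∧ (x l).val = 0) ↔ l = j := fun l => by
      simpa [mem_wordSupport] using Finset.ext_iff.1 hj l
    obtain ⟨hxi, hyi⟩ := (hi' i).2 rfl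
    obtain ⟨hyj, hxj⟩ := (hj' j).2 rfl
    refine ⟨i, j, ⟨hxi, hyi, hxj, hyj⟩, fun l hli hlj => ?_⟩
    by_cases hlx : (x l).val = 0
    · by_cases hly : (y l).val = 0
      · exact ext_of_val_eq_zero hlx hly
      · exact absurd ((hj' l).1 ⟨hly, hlx⟩) hlj
    · by_cases hly : (y l).val = 0
      · exact absurd ((hi' l).1 ⟨hlx, hly⟩) hli
      · have : l ∈ wordAgree x y := by
          rw [hagree, Finset.mem_inter, mem_wordSupport, mem_wordSupport]
          exact ⟨hlx, hly⟩
        exact (mem_wordAgree.1 this).1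

end Combinatorics

section WordOperators

variable (q n k : ℕ)

/-- The operator on words exchanging a nonzero letter for a different nonzero letter. -/
def wordReplace : Matrix (Fin n → Fin (q + 1)) (Fin n → Fin (q + 1)) ℚ :=
  siteSum fun _ => letterRaise q * letterLower q - letterOcc q

/-- The operator on words moving a nonzero letter to an empty position, with arbitrary new
nonzero value. -/
def wordMove : Matrix (Fin n → Fin (q + 1)) (Fin n → Fin (q + 1)) ℚ :=
  (siteSum fun _ => letterRaise q) * (siteSum fun _ => letterLower q) -
    siteSum fun _ => letterRaise q * letterLower q

/-- The restriction of functions on all words to the words of weight `k`. -/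
def weightRestrict (r n k : ℕ) : Matrix (JohnsonVertex r n k) (Fin n → Fin r) ℚ :=
  (1 : Matrix (Fin n → Fin r) (Fin n → Fin r) ℚ).submatrix Subtype.val id

variable {q n k} {r : ℕ}

lemma weightRestrict_mul (X : Matrix (Fin n → Fin r) (Fin n → Fin r) ℚ) :
    weightRestrict r n k * X = X.submatrix Subtype.val id := by
  ext x y
  simp [weightRestrict, Matrix.mul_apply, Matrix.one_apply]

lemma mul_weightRestrict_apply (A : Matrix (JohnsonVertex r n k) (JohnsonVertex r n k) ℚ)
    (x : JohnsonVertex r n k) (y : Fin n → Fin r) :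
    (A * weightRestrict r n k) x y =
      if h : (wordSupport y).card = k then A x ⟨y, h⟩ else 0 := by
  rw [Matrix.mul_apply]
  split_ifs with h
  · rw [Finset.sum_eq_single ⟨y, h⟩]
    · rw [weightRestrict, Matrix.submatrix_apply, id, Matrix.one_apply_eq, mul_one]
    · intro z _ hz
      have : z.1 ≠ y := fun h' => hz (Subtype.ext h')
      rw [weightRestrict, Matrix.submatrix_apply, id, Matrix.one_apply_ne this, mul_zero]
    · simp
  · refine Finset.sum_eq_zero fun z _ => ?_
    have : z.1 ≠ y := by
      rintro rfl
      exact h z.2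
    rw [weightRestrict, Matrix.submatrix_apply, id, Matrix.one_apply_ne this, mul_zero]

lemma eq_of_mul_weightRestrict_eq {A B : Matrix (JohnsonVertex r n k) (JohnsonVertex r n k) ℚ}
    (h : A * weightRestrict r n k = B * weightRestrict r n k) : A = B := by
  ext x y
  have := congr_fun (congr_fun h x) y.1
  have hy : (wordSupport y.1).card = k := y.2
  rwa [mul_weightRestrict_apply, mul_weightRestrict_apply, dif_pos hy, dif_pos hy] at this

lemma siteSum_indicator_occ (s : Fin n → Prop) [DecidablePred s] :
    siteSum (fun i : Fin n => if s i then letterOcc q else 0) =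
      Matrix.diagonal fun y : Fin n → Fin (q + 1) =>
        ((Finset.univ.filter fun i => s i ∧ (y i).val ≠ 0).card : ℚ) := by
  have h : ∀ i : Fin n, (if s i then letterOcc q else 0) =
      Matrix.diagonal fun a : Fin (q + 1) => if s i ∧ a.val ≠ 0 then (1 : ℚ) else 0 := by
    intro i
    by_cases hi : s i <;> simp [hi, letterOcc]
  rw [siteSum_apply]
  simp only [h, siteOp_diagonal]
  ext x y
  rw [Matrix.sum_apply]
  by_cases hxy : x = y
  · subst hxy
    simp
  · simp [hxy]

lemma weightRestrict_mul_occ :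
    weightRestrict (q + 1) n k *
        (siteSum fun _ => letterOcc q : Matrix (Fin n → Fin (q + 1)) (Fin n → Fin (q + 1)) ℚ) =
      (k : ℚ) • weightRestrict (q + 1) n k := by
  have h := siteSum_indicator_occ (q := q) (n := n) fun _ => True
  simp only [if_true, true_and] at h
  rw [weightRestrict_mul, h]
  ext x y
  have hx := x.2
  rw [Matrix.smul_apply, weightRestrict, Matrix.submatrix_apply, Matrix.submatrix_apply, id]
  by_cases hxy : x.1 = y
  · rw [← hxy, Matrix.diagonal_apply_eq, Matrix.one_apply_eq, hx, smul_eq_mul, mul_one]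
  · rw [Matrix.diagonal_apply_ne _ hxy, Matrix.one_apply_ne hxy, smul_zero]

lemma weightRestrict_mul_common (x0 : Fin n → Fin (q + 1)) :
    weightRestrict (q + 1) n k *
        (siteSum fun i => if (x0 i).val ≠ 0 then letterOcc q else 0 :
          Matrix (Fin n → Fin (q + 1)) (Fin n → Fin (q + 1)) ℚ) =
      (Matrix.diagonal fun y : JohnsonVertex (q + 1) n k => (ccnt x0 y.1 : ℚ)) *
        weightRestrict (q + 1) n k := by
  rw [siteSum_indicator_occ, weightRestrict_mul]
  ext x y
  rw [Matrix.diagonal_mul, weightRestrict, Matrix.submatrix_apply, Matrix.submatrix_apply, id]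
  by_cases hxy : x.1 = y
  · rw [← hxy, Matrix.diagonal_apply_eq, Matrix.one_apply_eq, mul_one, ccnt]
  · rw [Matrix.diagonal_apply_ne _ hxy, Matrix.one_apply_ne hxy, mul_zero]

lemma wordReplace_apply (x y : Fin n → Fin (q + 1)) :
    wordReplace q n x y =
      if ∃ i, (x i).val ≠ 0 ∧ (y i).val ≠ 0 ∧ x i ≠ y i ∧ ∀ l, l ≠ i → x l = y l
        then 1 else 0 := by
  have hentry : ∀ i : Fin n, siteOp i (letterRaise q * letterLower q - letterOcc q) x y =
      if (x i).val ≠ 0 ∧ (y i).val ≠ 0 ∧ x i ≠ y i ∧ ∀ l, l ≠ i → x l = y l then 1 else 0 := by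
    intro i
    rw [siteOp_apply, Matrix.sub_apply, letterRaise_mul_letterLower_apply, letterOcc,
      Matrix.diagonal_apply]
    by_cases hl : ∀ l, l ≠ i → x l = y l
    · by_cases hxy : x i = y i
      · simp [hxy]
      · simp [hxy, eq_true hl]
    · rw [if_neg hl, if_neg fun h => hl h.2.2.2]
  rw [wordReplace, siteSum_apply, Matrix.sum_apply]
  simp only [hentry]
  split_ifs with h
  · obtain ⟨i, hi⟩ := h
    rw [Finset.sum_eq_single i, if_pos hi]
    · intro j _ hj
      rw [if_neg]
      exact fun h => h.2.2.1 (hi.2.2.2 j hj)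
    · simp
  · exact Finset.sum_eq_zero fun i _ => if_neg fun hi => h ⟨i, hi⟩

lemma wordMove_apply (x y : Fin n → Fin (q + 1)) :
    wordMove q n x y =
      if ∃ i j, ((x i).val ≠ 0 ∧ (y i).val = 0 ∧ (x j).val = 0 ∧ (y j).val ≠ 0) ∧
          ∀ l, l ≠ i → l ≠ j → x l = y l
        then 1 else 0 := by
  have hentry : ∀ i j : Fin n, i ≠ j →
      (siteOp i (letterRaise q) * siteOp j (letterLower q)) x y =
        if ((x i).val ≠ 0 ∧ (y i).val = 0 ∧ (x j).val = 0 ∧ (y j).val ≠ 0) ∧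
          ∀ l, l ≠ i → l ≠ j → x l = y l then 1 else 0 := by
    intro i j hij
    rw [siteOp_mul_siteOp_apply hij, letterRaise, letterLower, Matrix.of_apply, Matrix.of_apply,
      ite_zero_mul_ite_zero, mul_one]
    split_ifs <;> first | rfl | (exfalso; tauto)
  have hsum : wordMove q n x y = ∑ i : Fin n, ∑ j : Fin n,
      if ((x i).val ≠ 0 ∧ (y i).val = 0 ∧ (x j).val = 0 ∧ (y j).val ≠ 0) ∧
          ∀ l, l ≠ i → l ≠ j → x l = y l then 1 else 0 := by
    rw [wordMove, siteSum_apply, siteSum_apply, siteSum_apply, Finset.sum_mul_sum,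
      ← Finset.sum_sub_distrib, Matrix.sum_apply]
    refine Finset.sum_congr rfl fun i _ => ?_
    rw [← Finset.add_sum_erase _ _ (Finset.mem_univ i), siteOp_mul_siteOp_same, add_sub_cancel_left,
      Matrix.sum_apply, ← Finset.add_sum_erase _ _ (Finset.mem_univ i), if_neg, zero_add]
    · exact Finset.sum_congr rfl fun j hj => hentry i j (Finset.ne_of_mem_erase hj).symm
    · exact fun h => h.1.1 h.1.2.2.1
  rw [hsum]
  split_ifs with h
  · obtain ⟨i, j, hij⟩ := h
    obtain ⟨⟨hxi, hyi, hxj, hyj⟩, hl⟩ := hij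
    have huniq : ∀ i' j', (((x i').val ≠ 0 ∧ (y i').val = 0 ∧ (x j').val = 0 ∧ (y j').val ≠ 0) ∧
          ∀ l, l ≠ i' → l ≠ j' → x l = y l) → i' = i ∧ j' = j := by
      rintro i' j' ⟨⟨hxi', hyi', hxj', hyj'⟩, -⟩
      constructor
      · by_contra hne
        have hne' : i' ≠ j := by
          rintro rfl
          exact hxi' hxj
        exact hxi' (hl i' hne hne' ▸ hyi')
      · by_contra hne
        have hne' : j' ≠ i := by
          rintro rfl
          exact hxi hxj'
        exact hyj' (hl j' hne' hne ▸ hxj')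
    rw [Finset.sum_eq_single i, Finset.sum_eq_single j, if_pos ⟨⟨hxi, hyi, hxj, hyj⟩, hl⟩]
    · exact fun j' _ hj' => if_neg fun h => hj' (huniq _ _ h).2
    · simp
    · exact fun i' _ hi' => Finset.sum_eq_zero fun j' _ => if_neg fun h => hi' (huniq _ _ h).1
    · simp
  · exact Finset.sum_eq_zero fun i _ => Finset.sum_eq_zero fun j _ =>
      if_neg fun hij => h ⟨i, j, hij⟩

lemma weightRestrict_mul_wordReplace :
    weightRestrict (q + 1) n k * wordReplace q n =
      Amat (q + 1) n k 1 0 * weightRestrict (q + 1) n k := by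
  rw [weightRestrict_mul]
  ext x y
  have hx : (wordSupport x.1).card = k := x.2
  rw [mul_weightRestrict_apply, Matrix.submatrix_apply, id, wordReplace_apply,
    if_congr (exists_replacement_iff hx) rfl rfl]
  split_ifs with h1 h2 h2
  · rw [Amat, if_neg (by decide), Matrix.of_apply, if_pos (by dsimp only; omega)]
  · exact absurd h1.1 h2
  · rw [Amat, if_neg (by decide), Matrix.of_apply, if_neg (by dsimp only; omega)]
  · rfl

lemma weightRestrict_mul_wordMove :
    weightRestrict (q + 1) n k * wordMove q n =
      Amat (q + 1) n k 0 1 * weightRestrict (q + 1) n k := by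
  rw [weightRestrict_mul]
  ext x y
  have hx : (wordSupport x.1).card = k := x.2
  rw [mul_weightRestrict_apply, Matrix.submatrix_apply, id, wordMove_apply,
    if_congr (exists_move_iff hx) rfl rfl]
  split_ifs with h1 h2 h2
  · rw [Amat, if_neg (by decide), Matrix.of_apply, if_pos (by dsimp only; omega)]
  · exact absurd h1.1 h2
  · rw [Amat, if_neg (by decide), Matrix.of_apply, if_neg (by dsimp only; omega)]
  · rfl

end WordOperators

section Relations

variable {q n k : ℕ}

/-- The number of nonzero letters of a word, as an operator. -/
def wordWeight (q n : ℕ) : Matrix (Fin n → Fin (q + 1)) (Fin n → Fin (q + 1)) ℚ :=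
  siteSum fun _ => letterOcc q

/-- The number of nonzero letters of a word at the positions in `s`, as an operator. -/
def wordWeightOn (q : ℕ) {n : ℕ} (s : Fin n → Prop) [DecidablePred s] :
    Matrix (Fin n → Fin (q + 1)) (Fin n → Fin (q + 1)) ℚ :=
  siteSum fun i => if s i then letterOcc q else 0

lemma siteSum_raise_lower :
    (siteSum fun _ => letterRaise q * letterLower q :
      Matrix (Fin n → Fin (q + 1)) (Fin n → Fin (q + 1)) ℚ) =
      wordReplace q n + wordWeight q n := by
  rw [wordReplace, wordWeight, ← map_add]
  congr 1
  funext i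
  simp

lemma siteSum_lower_raise_sub :
    (siteSum fun _ => letterLower q * letterRaise q - letterRaise q * letterLower q :
      Matrix (Fin n → Fin (q + 1)) (Fin n → Fin (q + 1)) ℚ) =
      ((q : ℚ) * n) • 1 - (q : ℚ) • wordWeight q n - (wordReplace q n + wordWeight q n) := by
  have h1 := siteSum_one (ι := Fin n) (α := Fin (q + 1))
  rw [Fintype.card_fin] at h1
  rw [← siteSum_raise_lower, wordWeight, mul_smul, ← h1, ← map_smul, ← map_smul, ← map_sub,
    ← map_sub]
  congr 1
  funext i
  simp [letterLower_mul_letterRaise, smul_sub]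

lemma siteSum_raise_lower_commute {L : Fin n → Matrix (Fin (q + 1)) (Fin (q + 1)) ℚ}
    (hL : ∀ i, letterRaise q * letterLower q * L i = L i * (letterRaise q * letterLower q)) :
    (wordReplace q n + wordWeight q n) * siteSum L =
      siteSum L * (wordReplace q n + wordWeight q n) := by
  rw [← sub_eq_zero, ← siteSum_raise_lower, siteSum_commutator, ← map_zero siteSum]
  congr 1
  funext i
  simp [hL i]

lemma raise_lower_mul_occ :
    letterRaise q * letterLower q * letterOcc q = letterOcc q * (letterRaise q * letterLower q) := by
  rw [mul_assoc, letterLower_mul_letterOcc, ← mul_assoc, letterOcc_mul_letterRaise]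

lemma wordWeightOn_commute (s : Fin n → Prop) [DecidablePred s] :
    (wordReplace q n + wordWeight q n) * wordWeightOn q s =
      wordWeightOn q s * (wordReplace q n + wordWeight q n) := by
  refine siteSum_raise_lower_commute fun i => ?_
  split_ifs
  · exact raise_lower_mul_occ
  · simp

lemma wordWeight_mul_wordWeightOn (s : Fin n → Prop) [DecidablePred s] :
    wordWeight q n * wordWeightOn q s = wordWeightOn q s * wordWeight q n := by
  rw [← sub_eq_zero, wordWeight, wordWeightOn, siteSum_commutator, ← map_zero siteSum]
  congr 1
  funext i
  split_ifs <;> simp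

lemma commutator_raise_lower_raise :
    (wordReplace q n + wordWeight q n) * (siteSum fun _ => letterRaise q) -
      (siteSum fun _ => letterRaise q) * (wordReplace q n + wordWeight q n) =
      (q : ℚ) • siteSum fun _ => letterRaise q := by
  rw [← siteSum_raise_lower, siteSum_commutator, ← map_smul]
  congr 1
  funext i
  rw [letterRaise_lower_raise, ← mul_assoc, letterRaise_mul_letterRaise, zero_mul, sub_zero]
  rfl

lemma commutator_raise_lower_lower :
    (wordReplace q n + wordWeight q n) * (siteSum fun _ => letterLower q) -
      (siteSum fun _ => letterLower q) * (wordReplace q n + wordWeight q n) =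
      -((q : ℚ) • siteSum fun _ => letterLower q) := by
  rw [← siteSum_raise_lower, siteSum_commutator, ← map_smul, ← map_neg]
  congr 1
  funext i
  rw [← mul_assoc, letterLower_raise_lower, mul_assoc, letterLower_mul_letterLower, mul_zero,
    zero_sub]
  rfl

lemma raise_lower_commute_wordMove :
    (wordReplace q n + wordWeight q n) * wordMove q n =
      wordMove q n * (wordReplace q n + wordWeight q n) := by
  rw [wordMove, siteSum_raise_lower]
  linear_combination
    (norm := (simp only [mul_sub, sub_mul, mul_add, add_mul, smul_mul_assoc, mul_smul_comm,
      mul_assoc, mul_neg]; module))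
    (commutator_raise_lower_raise (q := q) (n := n)) * (siteSum fun _ => letterLower q) +
      (siteSum fun _ => letterRaise q) * (commutator_raise_lower_lower (q := q) (n := n))

lemma wordWeight_commute_wordMove :
    wordWeight q n * wordMove q n = wordMove q n * wordWeight q n := by
  have h1 : wordWeight q n * (siteSum fun _ => letterRaise q) -
      (siteSum fun _ => letterRaise q) * wordWeight q n = siteSum fun _ => letterRaise q := by
    rw [wordWeight, siteSum_commutator]
    simp only [letterOcc_mul_letterRaise, letterRaise_mul_letterOcc, sub_zero]
  have h2 : wordWeight q n * (siteSum fun _ => letterLower q) -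
      (siteSum fun _ => letterLower q) * wordWeight q n = -siteSum fun _ => letterLower q := by
    rw [wordWeight, siteSum_commutator, ← map_neg]
    simp only [letterOcc_mul_letterLower, letterLower_mul_letterOcc, zero_sub]
    rfl
  have h3 : wordWeight q n * (wordReplace q n + wordWeight q n) =
      (wordReplace q n + wordWeight q n) * wordWeight q n :=
    (siteSum_raise_lower_commute fun _ => raise_lower_mul_occ).symm
  rw [wordMove, siteSum_raise_lower]
  linear_combination (norm := noncomm_ring)
    h1 * (siteSum fun _ => letterLower q) + (siteSum fun _ => letterRaise q) * h2 - h3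

/-- The cubic relation between `wordMove` and the weight on a set of positions, before
restriction to words of fixed weight. -/
lemma wordMove_cubic_relation (s : Fin n → Prop) [DecidablePred s]
    {b c y w g h : Matrix (Fin n → Fin (q + 1)) (Fin n → Fin (q + 1)) ℚ}
    (hb : b = wordMove q n) (hc : c = wordWeightOn q s)
    (hy : y = b * c - c * b) (hw : w = b * y - y * b)
    (hg : g = wordReplace q n + wordWeight q n)
    (hh : h = ((q : ℚ) * n) • 1 - (q : ℚ) • wordWeight q n - g) :
    b * w - w * b = (2 * (q : ℚ)) • (b * b * c - c * (b * b)) +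
      (h * h + (2 * (q : ℚ)) • h + (4 * (q : ℚ)) • g) * y := by
  have hgb : g * b = b * g := by rw [hg, hb, raise_lower_commute_wordMove]
  have hgc : g * c = c * g := by rw [hg, hc, wordWeightOn_commute]
  have hgy : g * y = y * g := by
    rw [hy]
    linear_combination (norm := noncomm_ring) hgb * c + b * hgc - hgc * b - c * hgb
  have hgw : g * w = w * g := by
    rw [hw]
    linear_combination (norm := noncomm_ring) hgb * y + b * hgy - hgy * b - y * hgb
  rw [hg, ← siteSum_lower_raise_sub] at hh
  have hm : b + g = (siteSum fun _ => letterRaise q) * (siteSum fun _ => letterLower q) := by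
    rw [hb, hg, wordMove, siteSum_raise_lower, sub_add_cancel]
  have hphp : letterRaise q * (letterLower q * letterRaise q) = (q : ℚ) • letterRaise q := by
    rw [← mul_assoc, letterRaise_lower_raise]
  have hmpm : letterLower q * (letterRaise q * letterLower q) = (q : ℚ) • letterLower q := by
    rw [← mul_assoc, letterLower_raise_lower]
  have key := cubic_relation_of_vector_operator (q : ℚ) (c := c) (h := h)
    (e := siteSum fun _ : Fin n => letterRaise q) (f := siteSum fun _ : Fin n => letterLower q)
    (e' := siteSum fun i => if s i then letterRaise q else 0)
    (f' := siteSum fun i => if s i then letterLower q else 0)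
    (h' := siteSum fun i => if s i then
      letterLower q * letterRaise q - letterRaise q * letterLower q else 0)
    ?_ ?_ ?_ ?_ ?_ ?_ ?_ ?_ ?_ ?_ ?_ ?_ hm rfl rfl
  · have hyg : (b + g) * c - c * (b + g) = y := by
      rw [hy]
      linear_combination (norm := noncomm_ring) hgc
    have hwg : (b + g) * y - y * (b + g) = w := by
      rw [hw]
      linear_combination (norm := noncomm_ring) hgy
    rw [hyg, hwg] at key
    have hsq : (b + g) * (b + g) * c - c * ((b + g) * (b + g)) =
        b * b * c - c * (b * b) + (2 : ℚ) • (g * y) := by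
      rw [hy]
      linear_combination
        (norm := (simp only [mul_sub, mul_add, add_mul, mul_assoc]; module))
        -hgb * c + c * hgb + g * hgc + hgc * g + (2 : ℚ) • (hgc * b)
    rw [hsq] at key
    linear_combination
      (norm := (simp only [mul_add, add_mul, smul_mul_assoc, mul_assoc]; module))
      key - hgw
  · rw [hh, siteSum_commutator]
  all_goals
    simp only [hh, hc, wordWeightOn, siteSum_commutator, ← map_smul, ← map_neg, ← map_zero siteSum]
    congr 1
    try
      funext i
      try simp only [Pi.smul_apply, Pi.neg_apply, Pi.zero_apply]
      try split_ifs
      all_goals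
        simp only [sub_mul, mul_sub, mul_assoc, hphp, hmpm, letterRaise_mul_letterRaise,
          letterLower_mul_letterLower, letterOcc_mul_letterRaise, letterRaise_mul_letterOcc,
          letterOcc_mul_letterLower, letterLower_mul_letterOcc, mul_zero, zero_mul]
        try simp only [← mul_assoc, letterRaise_mul_letterRaise, letterLower_mul_letterLower,
          zero_mul]
        try module

end Relations

section Restriction

variable {r n k : ℕ} {X Y : Matrix (Fin n → Fin r) (Fin n → Fin r) ℚ}
  {A B : Matrix (JohnsonVertex r n k) (JohnsonVertex r n k) ℚ}

/-- The operator `X` on all words induces the operator `A` on words of weight `k`. -/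
def RestrictsTo (X : Matrix (Fin n → Fin r) (Fin n → Fin r) ℚ)
    (A : Matrix (JohnsonVertex r n k) (JohnsonVertex r n k) ℚ) : Prop :=
  weightRestrict r n k * X = A * weightRestrict r n k

namespace RestrictsTo

lemma mul (hX : RestrictsTo X A) (hY : RestrictsTo Y B) : RestrictsTo (X * Y) (A * B) := by
  unfold RestrictsTo at *
  rw [← Matrix.mul_assoc, hX, Matrix.mul_assoc, hY, Matrix.mul_assoc]

lemma add (hX : RestrictsTo X A) (hY : RestrictsTo Y B) : RestrictsTo (X + Y) (A + B) := by
  unfold RestrictsTo at *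
  rw [Matrix.mul_add, hX, hY, Matrix.add_mul]

lemma sub (hX : RestrictsTo X A) (hY : RestrictsTo Y B) : RestrictsTo (X - Y) (A - B) := by
  unfold RestrictsTo at *
  rw [Matrix.mul_sub, hX, hY, Matrix.sub_mul]

lemma smul (c : ℚ) (hX : RestrictsTo X A) : RestrictsTo (c • X) (c • A) := by
  unfold RestrictsTo at *
  rw [Matrix.mul_smul, hX, Matrix.smul_mul]

lemma one : RestrictsTo (1 : Matrix (Fin n → Fin r) (Fin n → Fin r) ℚ)
    (1 : Matrix (JohnsonVertex r n k) (JohnsonVertex r n k) ℚ) := by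
  unfold RestrictsTo
  rw [Matrix.mul_one, Matrix.one_mul]

lemma unique (hX : RestrictsTo X A) (hX' : RestrictsTo X B) : A = B :=
  eq_of_mul_weightRestrict_eq (hX.symm.trans hX')

end RestrictsTo

end Restriction

section JohnsonRelations

variable {q n k : ℕ}

lemma restrictsTo_wordMove : RestrictsTo (wordMove q n) (Amat (q + 1) n k 0 1) :=
  weightRestrict_mul_wordMove

lemma restrictsTo_wordReplace : RestrictsTo (wordReplace q n) (Amat (q + 1) n k 1 0) :=
  weightRestrict_mul_wordReplace

lemma restrictsTo_wordWeight : RestrictsTo (wordWeight q n)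
    ((k : ℚ) • (1 : Matrix (JohnsonVertex (q + 1) n k) (JohnsonVertex (q + 1) n k) ℚ)) := by
  rw [RestrictsTo, Matrix.smul_mul, Matrix.one_mul]
  exact weightRestrict_mul_occ

lemma restrictsTo_wordWeightOn (x0 : Fin n → Fin (q + 1)) :
    RestrictsTo (wordWeightOn q fun i => (x0 i).val ≠ 0)
      (Matrix.diagonal fun y : JohnsonVertex (q + 1) n k => (ccnt x0 y.1 : ℚ)) :=
  weightRestrict_mul_common x0

lemma Amat_one_zero_commute :
    Amat (q + 1) n k 1 0 * Amat (q + 1) n k 0 1 = Amat (q + 1) n k 0 1 * Amat (q + 1) n k 1 0 := by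
  have h : wordReplace q n * wordMove q n = wordMove q n * wordReplace q n := by
    linear_combination (norm := noncomm_ring)
      (raise_lower_commute_wordMove (q := q) (n := n)) - (wordWeight_commute_wordMove (n := n))
  exact (restrictsTo_wordReplace.mul restrictsTo_wordMove).unique
    (h ▸ restrictsTo_wordMove.mul restrictsTo_wordReplace)

/-- The cubic relation between `A_{01}` and the number of nonzero letters shared with `x0`. -/
lemma johnson_cubic_relation (x0 : Fin n → Fin (q + 1))
    {A T C y w h : Matrix (JohnsonVertex (q + 1) n k) (JohnsonVertex (q + 1) n k) ℚ}
    (hA : A = Amat (q + 1) n k 0 1) (hT : T = Amat (q + 1) n k 1 0)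
    (hC : C = Matrix.diagonal fun y => (ccnt x0 y.1 : ℚ))
    (hy : y = A * C - C * A) (hw : w = A * y - y * A)
    (hh : h = ((q : ℚ) * n) • 1 - (q : ℚ) • ((k : ℚ) • 1) - (T + (k : ℚ) • 1)) :
    A * w - w * A = (2 * (q : ℚ)) • (A * A * C - C * (A * A)) +
      (h * h + (2 * (q : ℚ)) • h + (4 * (q : ℚ)) • (T + (k : ℚ) • 1)) * y := by
  have rA : RestrictsTo (wordMove q n) A := hA ▸ restrictsTo_wordMove
  have rC : RestrictsTo (wordWeightOn q fun i => (x0 i).val ≠ 0) C :=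
    hC ▸ restrictsTo_wordWeightOn x0
  have rG : RestrictsTo (wordReplace q n + wordWeight q n) (T + (k : ℚ) • 1) :=
    (hT ▸ restrictsTo_wordReplace).add restrictsTo_wordWeight
  have rh : RestrictsTo _ h :=
    hh ▸ ((RestrictsTo.one.smul _).sub (restrictsTo_wordWeight.smul _)).sub rG
  have ry : RestrictsTo _ y := hy ▸ (rA.mul rC).sub (rC.mul rA)
  have rW : RestrictsTo _ w := hw ▸ (rA.mul ry).sub (ry.mul rA)
  have rleft := (rA.mul rW).sub (rW.mul rA)
  rw [wordMove_cubic_relation (fun i => (x0 i).val ≠ 0) rfl rfl rfl rfl rfl rfl] at rleft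
  exact rleft.unique ((((rA.mul rA).mul rC).sub (rC.mul (rA.mul rA))).smul _ |>.add
    ((((rh.mul rh).add (rh.smul _)).add (rG.smul _)).mul ry))

end JohnsonRelations

/-- The centrally extended tridiagonal relation satisfied by `A_{01}`, `A*_{01}`, `A_{10}`
in the subconstituent algebra of the non-binary Johnson scheme, for `n ≥ 2k - 1`. -/
theorem johnson_tridiagonal (r n k : ℕ) (hr : 3 ≤ r) (hk1 : 1 ≤ k) (hkn : k + 1 ≤ n)
    (hn2k : 2 * (k : ℤ) - 1 ≤ n) (x0 : JohnsonVertex r n k)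
    (c1 c2 : ℚ)
    (hc1 : c1 = (n : ℚ) * ((n : ℚ) + 2) * ((r : ℚ) - 1) ^ 2 + (k : ℚ) ^ 2 * (r : ℚ) ^ 2
        - 2 * k * ((r : ℚ) - 1) * ((r : ℚ) * ((n : ℚ) + 1) - 2))
    (hc2 : c2 = 2 * ((k : ℚ) * r - ((n : ℚ) - 1) * ((r : ℚ) - 1))) :
    mcomm (Amat r n k 0 1)
      ((2 : ℚ) • (Amat r n k 0 1 * Astar01 r n k x0 * Amat r n k 0 1)
        - ((Amat r n k 0 1) ^ 2 * Astar01 r n k x0 + Astar01 r n k x0 * (Amat r n k 0 1) ^ 2)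
        + (2 * ((r : ℚ) - 1)) • (Amat r n k 0 1 * Astar01 r n k x0
            + Astar01 r n k x0 * Amat r n k 0 1)
        + (c1 • (1 : Matrix (JohnsonVertex r n k) (JohnsonVertex r n k) ℚ)
            + c2 • Amat r n k 1 0 + (Amat r n k 1 0) ^ 2) * Astar01 r n k x0)
  = 0 := by
  obtain ⟨q, rfl⟩ : ∃ q, r = q + 1 := ⟨r - 1, by omega⟩
  set A := Amat (q + 1) n k 0 1 with hA
  set T := Amat (q + 1) n k 1 0 with hT
  obtain ⟨C, hC⟩ : ∃ C : Matrix (JohnsonVertex (q + 1) n k) (JohnsonVertex (q + 1) n k) ℚ,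
      C = Matrix.diagonal fun y => (ccnt x0.1 y.1 : ℚ) := ⟨_, rfl⟩
  obtain ⟨u, v, hD⟩ : ∃ u v : ℚ, Astar01 (q + 1) n k x0 = u • 1 + v • C := by
    refine ⟨((n : ℚ) - 1) * (1 - n * k / (k * (n - k))), ((n : ℚ) - 1) * (n / (k * (n - k))), ?_⟩
    rw [hC, Astar01, ← Matrix.diagonal_one, ← Matrix.diagonal_smul, ← Matrix.diagonal_smul,
      Matrix.diagonal_add]
    congr 1
    funext y
    simp only [muStar, Pi.smul_apply, smul_eq_mul]
    ring
  have hTA : T * A = A * T := Amat_one_zero_commute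
  have key := johnson_cubic_relation x0.1 hA hT hC rfl rfl rfl
  have hTT : T ^ 2 = T * T := sq T
  have hP : ∀ y : Matrix (JohnsonVertex (q + 1) n k) (JohnsonVertex (q + 1) n k) ℚ,
      ((((q : ℚ) * n) • 1 - (q : ℚ) • ((k : ℚ) • 1) - (T + (k : ℚ) • 1)) *
        (((q : ℚ) * n) • 1 - (q : ℚ) • ((k : ℚ) • 1) - (T + (k : ℚ) • 1)) +
        (2 * (q : ℚ)) • (((q : ℚ) * n) • 1 - (q : ℚ) • ((k : ℚ) • 1) - (T + (k : ℚ) • 1)) +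
        (4 * (q : ℚ)) • (T + (k : ℚ) • 1)) * y = (c1 • 1 + c2 • T + T ^ 2) * y := by
    intro y
    congr 1
    rw [hc1, hc2, hTT]
    push_cast
    simp only [mul_sub, sub_mul, mul_add, add_mul, smul_mul_assoc, mul_smul_comm, mul_one, one_mul]
    module
  rw [hP] at key
  have hPA : A * (c1 • 1 + c2 • T + T ^ 2) = (c1 • 1 + c2 • T + T ^ 2) * A := by
    rw [hTT]
    linear_combination
      (norm := (simp only [mul_add, add_mul, smul_mul_assoc, mul_smul_comm, mul_assoc, mul_one,
        one_mul]; module))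
      -(c2 • hTA) - T * hTA - hTA * T
  have hq : ((q + 1 : ℕ) : ℚ) - 1 = q := by
    push_cast
    ring
  rw [hD, mcomm, hq]
  generalize c1 • (1 : Matrix (JohnsonVertex (q + 1) n k) (JohnsonVertex (q + 1) n k) ℚ) +
    c2 • T + T ^ 2 = P at key hPA ⊢
  linear_combination
    (norm := (simp only [sq, mul_sub, sub_mul, mul_add, add_mul, smul_mul_assoc, mul_smul_comm,
      mul_assoc, mul_one, one_mul, smul_add, smul_sub]; module))
    -(v • key) + v • (hPA * C) + u • hPA
end

section
/- The bispectral operators of the non-binary Johnson scheme satisfy [X, Y] = 0 and [X, Y*] = 0, as identities of D×D matrices over ℚ. -/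
/-- The domain `D = {(i,j) ∈ ℕ² : i + j ≤ k and j ≤ min(k, n-k)}`. -/
abbrev Dset (n k : ℕ) := {p : ℕ × ℕ // p.1 + p.2 ≤ k ∧ p.2 ≤ min k (n - k)}

instance DsetFintype (n k : ℕ) : Fintype (Dset n k) :=
  Fintype.ofFinset
    ((Finset.range (k + 1) ×ˢ Finset.range (k + 1)).filter
      fun p => p.1 + p.2 ≤ k ∧ p.2 ≤ min k (n - k))
    (by
      intro p
      constructor
      · intro hp
        exact (Finset.mem_filter.mp hp).2
      · intro hp
        obtain ⟨h1, h2⟩ := hp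
        refine Finset.mem_filter.mpr
          ⟨Finset.mem_product.mpr ⟨Finset.mem_range.mpr ?_, Finset.mem_range.mpr ?_⟩, h1, h2⟩
        · omega
        · omega)

/-- The diagonal operator `X*`, `(X*)_{(i,j),(i,j)} = i`. -/
noncomputable def Xstar (n k : ℕ) : Matrix (Dset n k) (Dset n k) ℚ :=
  Matrix.diagonal fun p => (p.1.1 : ℚ)

/-- The diagonal operator `Y*`, `(Y*)_{(i,j),(i,j)} = j`. -/
noncomputable def Ystar (n k : ℕ) : Matrix (Dset n k) (Dset n k) ℚ :=
  Matrix.diagonal fun p => (p.1.2 : ℚ)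

/-- The recurrence operator `X`. -/
noncomputable def Xop (r n k : ℕ) : Matrix (Dset n k) (Dset n k) ℚ :=
  Matrix.of fun p q =>
    if q.1.2 = p.1.2 ∧ q.1.1 + 1 = p.1.1 then
      ((k : ℚ) - p.1.1 - p.1.2 + 1) * ((r : ℚ) - 2)
    else if q.1.2 = p.1.2 ∧ q.1.1 = p.1.1 then
      (p.1.1 : ℚ) * ((r : ℚ) - 3) + ((p.1.2 : ℚ) - (k : ℚ)) * ((r : ℚ) - 2)
    else if q.1.2 = p.1.2 ∧ q.1.1 = p.1.1 + 1 then
      (p.1.1 : ℚ) + 1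
    else 0

/-- The recurrence operator `Y`. -/
noncomputable def Yop (r n k : ℕ) : Matrix (Dset n k) (Dset n k) ℚ :=
  Matrix.of fun p q =>
    if q.1.1 + 1 = p.1.1 ∧ q.1.2 = p.1.2 then
      ((k : ℚ) - p.1.1 - p.1.2 + 1) * ((r : ℚ) - 2) * p.1.2
    else if q.1.1 = p.1.1 ∧ q.1.2 + 1 = p.1.2 then
      ((k : ℚ) - p.1.1 - p.1.2 + 1) * ((n : ℚ) - k - p.1.2 + 1) * ((r : ℚ) - 1)
    else if q.1.1 = p.1.1 + 1 ∧ q.1.2 = p.1.2 then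
      ((p.1.1 : ℚ) + 1) * p.1.2
    else if q.1.1 = p.1.1 ∧ q.1.2 = p.1.2 + 1 then
      ((p.1.2 : ℚ) + 1) ^ 2
    else if q.1.1 = p.1.1 + 1 ∧ q.1.2 + 1 = p.1.2 then
      ((p.1.1 : ℚ) + 1) * ((n : ℚ) - k - p.1.2 + 1) * ((r : ℚ) - 1)
    else if q.1.1 + 1 = p.1.1 ∧ q.1.2 = p.1.2 + 1 then
      ((p.1.2 : ℚ) + 1) ^ 2 * ((r : ℚ) - 2)
    else if q.1.1 = p.1.1 ∧ q.1.2 = p.1.2 then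
      (p.1.2 : ℚ) * ((k : ℚ) - p.1.1 - p.1.2 + ((r : ℚ) - 2) * p.1.1
        + ((n : ℚ) - k - p.1.2) * ((r : ℚ) - 1))
    else 0

/-- The integer points satisfying the inequalities that define `Dset n k`. -/
def InDomain (n k i j : ℤ) : Prop := 0 ≤ i ∧ 0 ≤ j ∧ i + j ≤ k ∧ j ≤ n - k

/-- The entry of `X` in row `(i, j)` and column `(i + a, j + b)`, extended to all of `ℤ²`. -/
def xKernel (r k i j a b : ℤ) : ℤ :=
  if a = -1 ∧ b = 0 then (k - i - j + 1) * (r - 2)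
  else if a = 0 ∧ b = 0 then i * (r - 3) + (j - k) * (r - 2)
  else if a = 1 ∧ b = 0 then i + 1
  else 0

/-- The entry of `Y` in row `(i, j)` and column `(i + a, j + b)`, extended to all of `ℤ²`. -/
def yKernel (r n k i j a b : ℤ) : ℤ :=
  if a = -1 ∧ b = 0 then (k - i - j + 1) * (r - 2) * j
  else if a = 0 ∧ b = -1 then (k - i - j + 1) * (n - k - j + 1) * (r - 1)
  else if a = 1 ∧ b = 0 then (i + 1) * j
  else if a = 0 ∧ b = 1 then (j + 1) ^ 2
  else if a = 1 ∧ b = -1 then (i + 1) * (n - k - j + 1) * (r - 1)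
  else if a = -1 ∧ b = 1 then (j + 1) ^ 2 * (r - 2)
  else if a = 0 ∧ b = 0 then j * (k - i - j + (r - 2) * i + (n - k - j) * (r - 1))
  else 0

theorem Xop_apply (r n k : ℕ) (p q : Dset n k) :
    Xop r n k p q = xKernel r k p.1.1 p.1.2 (q.1.1 - p.1.1) (q.1.2 - p.1.2) := by
  obtain ⟨⟨i, j⟩, _⟩ := p
  obtain ⟨⟨i', j'⟩, _⟩ := q
  simp only [Xop, xKernel, Matrix.of_apply]
  split_ifs <;> first | omega | (push_cast; ring)

theorem Yop_apply (r n k : ℕ) (p q : Dset n k) :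
    Yop r n k p q = yKernel r n k p.1.1 p.1.2 (q.1.1 - p.1.1) (q.1.2 - p.1.2) := by
  obtain ⟨⟨i, j⟩, _⟩ := p
  obtain ⟨⟨i', j'⟩, _⟩ := q
  have neg_one_iff (x y : ℕ) : (x : ℤ) - y = -1 ↔ x + 1 = y := by omega
  have zero_iff (x y : ℕ) : (x : ℤ) - y = 0 ↔ x = y := by omega
  have one_iff (x y : ℕ) : (x : ℤ) - y = 1 ↔ x = y + 1 := by omega
  simp only [Yop, yKernel, Matrix.of_apply, neg_one_iff, zero_iff, one_iff]
  push_cast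
  rfl

theorem xKernel_eq_zero_of_offset {r k i j a b : ℤ}
    (h : (a, b) ∉ Finset.Icc (-1 : ℤ) 1 ×ˢ Finset.Icc (-1 : ℤ) 1) : xKernel r k i j a b = 0 := by
  simp only [Finset.mem_product, Finset.mem_Icc] at h
  unfold xKernel
  split_ifs <;> first | rfl | omega

theorem yKernel_eq_zero_of_offset {r n k i j a b : ℤ}
    (h : (a, b) ∉ Finset.Icc (-1 : ℤ) 1 ×ˢ Finset.Icc (-1 : ℤ) 1) : yKernel r n k i j a b = 0 := by
  simp only [Finset.mem_product, Finset.mem_Icc] at h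
  unfold yKernel
  split_ifs <;> first | rfl | omega

/-- The kernel of `X` vanishes on entries leading from outside the domain into it. -/
theorem xKernel_eq_zero_of_not_inDomain {r n k i j a b : ℤ} (h : ¬ InDomain n k i j)
    (h' : InDomain n k (i + a) (j + b)) : xKernel r k i j a b = 0 := by
  unfold InDomain at h h'
  unfold xKernel
  split_ifs <;> (try simp only [mul_eq_zero]) <;> omega

/-- The kernel of `Y` vanishes on entries leading from outside the domain into it. -/
theorem yKernel_eq_zero_of_not_inDomain {r n k i j a b : ℤ} (h : ¬ InDomain n k i j)
    (h' : InDomain n k (i + a) (j + b)) : yKernel r n k i j a b = 0 := by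
  unfold InDomain at h h'
  unfold yKernel
  split_ifs <;> (try simp only [mul_eq_zero, pow_eq_zero_iff two_ne_zero]) <;> omega

theorem Dset.inDomain {n k : ℕ} (hkn : k ≤ n) (p : Dset n k) : InDomain n k p.1.1 p.1.2 := by
  obtain ⟨⟨i, j⟩, h₁, h₂⟩ := p
  dsimp only [InDomain] at *
  omega

theorem InDomain.exists_dset {n k : ℕ} (hkn : k ≤ n) {i j : ℤ} (h : InDomain n k i j) :
    ∃ p : Dset n k, (p.1.1 : ℤ) = i ∧ (p.1.2 : ℤ) = j := by
  unfold InDomain at h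
  exact ⟨⟨(i.toNat, j.toNat), by dsimp only; omega, by dsimp only; omega⟩,
    by dsimp only; omega, by dsimp only; omega⟩

/-- A sum over the domain of products of kernels is a sum over unit offsets, provided that the
second kernel vanishes on entries leading from outside the domain into it. -/
theorem sum_dset_kernel_mul {n k : ℕ} (hkn : k ≤ n) {A B : ℤ → ℤ → ℤ → ℤ → ℤ}
    (hA : ∀ {i j a b}, (a, b) ∉ Finset.Icc (-1 : ℤ) 1 ×ˢ Finset.Icc (-1 : ℤ) 1 → A i j a b = 0)
    (hB : ∀ {i j a b}, ¬ InDomain n k i j → InDomain n k (i + a) (j + b) → B i j a b = 0)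
    (p q : Dset n k) :
    ∑ s : Dset n k, A p.1.1 p.1.2 (s.1.1 - p.1.1) (s.1.2 - p.1.2) *
        B s.1.1 s.1.2 (q.1.1 - s.1.1) (q.1.2 - s.1.2) =
      ∑ d ∈ Finset.Icc (-1 : ℤ) 1 ×ˢ Finset.Icc (-1 : ℤ) 1, A p.1.1 p.1.2 d.1 d.2 *
        B (p.1.1 + d.1) (p.1.2 + d.2) (q.1.1 - p.1.1 - d.1) (q.1.2 - p.1.2 - d.2) := by
  refine Finset.sum_bij_ne_zero
    (fun s _ _ => ((s.1.1 : ℤ) - p.1.1, (s.1.2 : ℤ) - p.1.2)) ?_ ?_ ?_ ?_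
  · intro s _ hs
    by_contra h
    exact hs (by rw [hA h, zero_mul])
  · intro s _ _ t _ _ hst
    rw [Prod.mk.injEq] at hst
    exact Subtype.ext (Prod.ext (by omega) (by omega))
  · rintro ⟨a, b⟩ _ hd
    have hin : InDomain n k (p.1.1 + a) (p.1.2 + b) := by
      by_contra h
      refine hd ?_
      rw [hB h, mul_zero]
      convert Dset.inDomain hkn q using 1 <;> ring
    obtain ⟨s, hs₁, hs₂⟩ := hin.exists_dset hkn
    refine ⟨s, Finset.mem_univ _, ?_, ?_⟩
    · rw [hs₁, hs₂]
      simpa only [add_sub_cancel_left, sub_sub] using hd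
    · rw [hs₁, hs₂, add_sub_cancel_left, add_sub_cancel_left]
  · intro s _ _
    simp only [add_sub_cancel, sub_sub_sub_cancel_right]

theorem kernel_comm (r n k i j c d : ℤ) :
    ∑ e ∈ Finset.Icc (-1 : ℤ) 1 ×ˢ Finset.Icc (-1 : ℤ) 1,
        xKernel r k i j e.1 e.2 * yKernel r n k (i + e.1) (j + e.2) (c - e.1) (d - e.2) =
      ∑ e ∈ Finset.Icc (-1 : ℤ) 1 ×ˢ Finset.Icc (-1 : ℤ) 1,
        yKernel r n k i j e.1 e.2 * xKernel r k (i + e.1) (j + e.2) (c - e.1) (d - e.2) := by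
  by_cases h : (-2 ≤ c ∧ c ≤ 2) ∧ -2 ≤ d ∧ d ≤ 2
  · obtain ⟨⟨hc₁, hc₂⟩, hd₁, hd₂⟩ := h
    have hI : Finset.Icc (-1 : ℤ) 1 = {-1, 0, 1} := by decide
    rw [hI]
    simp only [Finset.sum_product, Finset.sum_insert, Finset.sum_singleton, Finset.mem_insert,
      Finset.mem_singleton, reduceCtorEq, Int.reduceNeg, Int.reduceEq, or_self, not_false_eq_true]
    interval_cases c <;> interval_cases d <;> simp [xKernel, yKernel] <;> ring
  · have hzero : ∀ e ∈ Finset.Icc (-1 : ℤ) 1 ×ˢ Finset.Icc (-1 : ℤ) 1,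
        (c - e.1, d - e.2) ∉ Finset.Icc (-1 : ℤ) 1 ×ˢ Finset.Icc (-1 : ℤ) 1 := by
      intro e he
      simp only [Finset.mem_product, Finset.mem_Icc] at he ⊢
      omega
    rw [Finset.sum_eq_zero fun e he => by rw [yKernel_eq_zero_of_offset (hzero e he), mul_zero],
      Finset.sum_eq_zero fun e he => by rw [xKernel_eq_zero_of_offset (hzero e he), mul_zero]]

/-- The bispectral operators of the non-binary Johnson scheme satisfy
`[X, Y] = 0` and `[X, Y*] = 0`. -/
theorem bispectral_commutations (r n k : ℕ) (hr : 3 ≤ r) (hk1 : 1 ≤ k) (hkn : k ≤ n) :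
    mcomm (Xop r n k) (Yop r n k) = 0 ∧ mcomm (Xop r n k) (Ystar n k) = 0 := by
  constructor
  · ext p q
    have hXY := sum_dset_kernel_mul hkn (A := xKernel r k) (B := yKernel r n k)
      xKernel_eq_zero_of_offset yKernel_eq_zero_of_not_inDomain p q
    have hYX := sum_dset_kernel_mul hkn (A := yKernel r n k) (B := xKernel r k)
      yKernel_eq_zero_of_offset xKernel_eq_zero_of_not_inDomain p q
    have h := hXY.trans ((kernel_comm r n k _ _ _ _).trans hYX.symm)
    simp only [mcomm, Matrix.sub_apply, Matrix.mul_apply, Xop_apply, Yop_apply, Matrix.zero_apply,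
      sub_eq_zero]
    exact_mod_cast h
  · ext p q
    simp only [mcomm, Ystar, Matrix.sub_apply, Matrix.mul_diagonal, Matrix.diagonal_mul,
      Matrix.zero_apply]
    by_cases h : q.1.2 = p.1.2
    · rw [h]
      ring
    · simp [Xop, h]
end

section
/- The bispectral operators X, X*, Y* of the non-binary Johnson scheme give a realization of the Lie algebra gl₂: as identities of D×D matrices over ℚ, [X*, [X*, X]] = X − (r−3)·X* − (r−2)·(Y* − k·I) and [X, [X*, X]] = (r−3)·X − (r−1)²·X* − (r−1)(r−2)·(Y* − k·I). -/
attribute [local instance] LieRing.ofAssociativeRing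

/-- The part of `X` lying below the diagonal in the first coordinate. -/
noncomputable def XopLower (r n k : ℕ) : Matrix (Dset n k) (Dset n k) ℚ :=
  Matrix.of fun p q =>
    if q.1.2 = p.1.2 ∧ q.1.1 + 1 = p.1.1 then
      ((k : ℚ) - p.1.1 - p.1.2 + 1) * ((r : ℚ) - 2)
    else 0

/-- The part of `X` lying above the diagonal in the first coordinate. -/
noncomputable def XopUpper (n k : ℕ) : Matrix (Dset n k) (Dset n k) ℚ :=
  Matrix.of fun p q =>
    if q.1.2 = p.1.2 ∧ q.1.1 = p.1.1 + 1 then (p.1.1 : ℚ) + 1 else 0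

theorem Dset.ext_iff {n k : ℕ} {p q : Dset n k} :
    p = q ↔ p.1.1 = q.1.1 ∧ p.1.2 = q.1.2 := by
  rw [Subtype.ext_iff, Prod.ext_iff]

theorem Xop_eq_add (r n k : ℕ) :
    Xop r n k = XopLower r n k + XopUpper n k + (((r : ℚ) - 3) • Xstar n k
      + ((r : ℚ) - 2) • (Ystar n k - (k : ℚ) • (1 : Matrix (Dset n k) (Dset n k) ℚ))) := by
  ext p q
  simp only [Xop, XopLower, XopUpper, Xstar, Ystar, Matrix.of_apply, Matrix.add_apply,
    Matrix.sub_apply, Matrix.smul_apply, Matrix.diagonal_apply, Matrix.one_apply, smul_eq_mul,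
    Dset.ext_iff]
  split_ifs <;> first | omega | ring

theorem lie_Xstar_XopLower (r n k : ℕ) : ⁅Xstar n k, XopLower r n k⁆ = XopLower r n k := by
  ext p q
  simp only [Ring.lie_def, Xstar, Matrix.sub_apply, Matrix.diagonal_mul, Matrix.mul_diagonal,
    XopLower, Matrix.of_apply]
  split_ifs with h
  · rw [← h.2]
    push_cast
    ring
  · ring

theorem lie_Xstar_XopUpper (n k : ℕ) : ⁅Xstar n k, XopUpper n k⁆ = -XopUpper n k := by
  ext p q
  simp only [Ring.lie_def, Xstar, Matrix.sub_apply, Matrix.neg_apply, Matrix.diagonal_mul,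
    Matrix.mul_diagonal, XopUpper, Matrix.of_apply]
  split_ifs with h
  · rw [h.2]
    push_cast
    ring
  · ring

theorem lie_Ystar_XopLower (r n k : ℕ) : ⁅Ystar n k, XopLower r n k⁆ = 0 := by
  ext p q
  simp only [Ring.lie_def, Ystar, Matrix.sub_apply, Matrix.zero_apply, Matrix.diagonal_mul,
    Matrix.mul_diagonal, XopLower, Matrix.of_apply]
  split_ifs with h
  · rw [h.1]
    ring
  · ring

theorem lie_Ystar_XopUpper (n k : ℕ) : ⁅Ystar n k, XopUpper n k⁆ = 0 := by
  ext p q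
  simp only [Ring.lie_def, Ystar, Matrix.sub_apply, Matrix.zero_apply, Matrix.diagonal_mul,
    Matrix.mul_diagonal, XopUpper, Matrix.of_apply]
  split_ifs with h
  · rw [h.1]
    ring
  · ring

theorem lie_Xstar_Ystar (n k : ℕ) : ⁅Xstar n k, Ystar n k⁆ = 0 := by
  rw [Ring.lie_def, Xstar, Ystar, Matrix.diagonal_mul_diagonal, Matrix.diagonal_mul_diagonal,
    sub_eq_zero]
  simp only [mul_comm]

theorem XopLower_mul_XopUpper (r n k : ℕ) :
    XopLower r n k * XopUpper n k = Matrix.diagonal fun p : Dset n k =>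
      ((k : ℚ) - p.1.1 - p.1.2 + 1) * ((r : ℚ) - 2) * p.1.1 := by
  ext p q
  simp only [Matrix.mul_apply, Matrix.diagonal_apply, XopLower, XopUpper, Matrix.of_apply]
  split_ifs with hpq
  · subst hpq
    obtain ⟨⟨_ | i, j⟩, hp⟩ := p
    · simp
    · rw [Finset.sum_eq_single ⟨(i, j), by dsimp only at hp ⊢; omega⟩]
      · simp
      · intro s _ hs
        rw [ne_eq, Dset.ext_iff] at hs
        rw [if_neg (by dsimp only at hs ⊢; omega), zero_mul]
      · simp
  · rw [Dset.ext_iff] at hpq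
    refine Finset.sum_eq_zero fun s _ => ?_
    split_ifs <;> first | omega | simp

theorem XopUpper_mul_XopLower (r n k : ℕ) :
    XopUpper n k * XopLower r n k = Matrix.diagonal fun p : Dset n k =>
      ((p.1.1 : ℚ) + 1) * (((k : ℚ) - p.1.1 - p.1.2) * ((r : ℚ) - 2)) := by
  ext p q
  simp only [Matrix.mul_apply, Matrix.diagonal_apply, XopLower, XopUpper, Matrix.of_apply]
  split_ifs with hpq
  · subst hpq
    obtain ⟨⟨i, j⟩, hp⟩ := p
    dsimp only at hp ⊢
    rcases hp.1.lt_or_eq with h | h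
    · rw [Finset.sum_eq_single ⟨(i + 1, j), by dsimp only; omega⟩]
      · rw [if_pos ⟨rfl, rfl⟩, if_pos ⟨rfl, rfl⟩]
        push_cast
        ring
      · intro s _ hs
        rw [ne_eq, Dset.ext_iff] at hs
        rw [if_neg (by dsimp only at hs ⊢; omega), zero_mul]
      · simp
    · have hk : (k : ℚ) - i - j = 0 := by
        rw [← h]
        push_cast
        ring
      rw [hk, zero_mul, mul_zero]
      refine Finset.sum_eq_zero fun s _ => ?_
      have hs := s.2.1
      rw [if_neg (by omega), zero_mul]
  · rw [Dset.ext_iff] at hpq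
    refine Finset.sum_eq_zero fun s _ => ?_
    split_ifs <;> first | omega | simp

theorem lie_XopLower_XopUpper (r n k : ℕ) :
    ⁅XopLower r n k, XopUpper n k⁆ = ((r : ℚ) - 2) • ((2 : ℚ) • Xstar n k
      + (Ystar n k - (k : ℚ) • (1 : Matrix (Dset n k) (Dset n k) ℚ))) := by
  rw [Ring.lie_def, XopLower_mul_XopUpper, XopUpper_mul_XopLower]
  ext p q
  simp only [Xstar, Ystar, Matrix.add_apply, Matrix.sub_apply, Matrix.smul_apply,
    Matrix.diagonal_apply, Matrix.one_apply, smul_eq_mul]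
  split_ifs <;> ring

theorem lie_Xstar_Xop (r n k : ℕ) :
    ⁅Xstar n k, Xop r n k⁆ = XopLower r n k - XopUpper n k := by
  have h1 : ⁅Xstar n k, (1 : Matrix (Dset n k) (Dset n k) ℚ)⁆ = 0 := by simp [Ring.lie_def]
  simp only [Xop_eq_add, lie_add, lie_sub, lie_smul, lie_self, lie_Xstar_XopLower,
    lie_Xstar_XopUpper, lie_Xstar_Ystar, h1]
  module

/-- The bispectral operators `X`, `X*`, `Y*` of the non-binary Johnson scheme give a
realization of the Lie algebra `gl₂`. -/
theorem bispectral_gl2 (r n k : ℕ) (hr : 3 ≤ r) (hk1 : 1 ≤ k) (hkn : k ≤ n) :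
    mcomm (Xstar n k) (mcomm (Xstar n k) (Xop r n k))
        = Xop r n k - ((r : ℚ) - 3) • Xstar n k
          - ((r : ℚ) - 2) • (Ystar n k - (k : ℚ) • (1 : Matrix (Dset n k) (Dset n k) ℚ))
  ∧ mcomm (Xop r n k) (mcomm (Xstar n k) (Xop r n k))
        = ((r : ℚ) - 3) • Xop r n k - (((r : ℚ) - 1) ^ 2) • Xstar n k
          - (((r : ℚ) - 1) * ((r : ℚ) - 2))
              • (Ystar n k - (k : ℚ) • (1 : Matrix (Dset n k) (Dset n k) ℚ)) := by
  have lie_eq (A B : Matrix (Dset n k) (Dset n k) ℚ) : mcomm A B = ⁅A, B⁆ := rfl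
  have one_lie (A : Matrix (Dset n k) (Dset n k) ℚ) :
      ⁅(1 : Matrix (Dset n k) (Dset n k) ℚ), A⁆ = 0 := by simp [Ring.lie_def]
  rw [lie_eq, lie_eq, lie_eq, lie_Xstar_Xop, Xop_eq_add]
  constructor
  · rw [lie_sub, lie_Xstar_XopLower, lie_Xstar_XopUpper]
    module
  · simp only [lie_sub, add_lie, sub_lie, smul_lie, lie_self, one_lie, lie_Xstar_XopLower,
      lie_Xstar_XopUpper, lie_Ystar_XopLower, lie_Ystar_XopUpper,
      ← lie_skew (XopUpper n k) (XopLower r n k), lie_XopLower_XopUpper]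
    module
end

section
/- The bispectral operators Y, Y*, X of the non-binary Johnson scheme satisfy the relations of a centrally extended Hahn algebra: as identities of D×D matrices over ℚ, [Y*, [Y*, Y]] = −2(1−r)·(Y*)² + (n(1−r)·I − X)·Y* + Y and [Y, [Y*, Y]] = −2(r−1)·(Y·Y* + Y*·Y) + Y·(X − n(1−r)·I) − 2(k−n)(r−1)·(X + k(r−1)·I) − Y*·(X² + 2(1−r)(n−2k−1)·X + (r−1)²(2n+(n−2k)²)·I). -/
/-- `ColumnRep A T` says that the matrix `A` acts on row vectors, given by restricting functions of
two rational variables to the domain, as the operator `T` on such functions. -/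
def ColumnRep {n k : ℕ} (A : Matrix (Dset n k) (Dset n k) ℚ)
    (T : (ℚ → ℚ → ℚ) → ℚ → ℚ → ℚ) : Prop :=
  ∀ (f : ℚ → ℚ → ℚ) (q : Dset n k),
    ∑ p : Dset n k, f p.1.1 p.1.2 * A p q = T f q.1.1 q.1.2

namespace ColumnRep

variable {n k : ℕ} {A B : Matrix (Dset n k) (Dset n k) ℚ} {S T : (ℚ → ℚ → ℚ) → ℚ → ℚ → ℚ}

theorem mul (hA : ColumnRep A S) (hB : ColumnRep B T) :
    ColumnRep (A * B) fun f => T (S f) := by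
  intro f q
  simp only [← hB (S f) q, ← hA f, Matrix.mul_apply, Finset.mul_sum, Finset.sum_mul, mul_assoc]
  exact Finset.sum_comm

theorem add (hA : ColumnRep A S) (hB : ColumnRep B T) :
    ColumnRep (A + B) fun f i j => S f i j + T f i j := by
  intro f q
  simp only [← hA f q, ← hB f q, Matrix.add_apply, mul_add, Finset.sum_add_distrib]

theorem sub (hA : ColumnRep A S) (hB : ColumnRep B T) :
    ColumnRep (A - B) fun f i j => S f i j - T f i j := by
  intro f q
  simp only [← hA f q, ← hB f q, Matrix.sub_apply, mul_sub, Finset.sum_sub_distrib]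

theorem smul (c : ℚ) (hA : ColumnRep A S) :
    ColumnRep (c • A) fun f i j => c * S f i j := by
  intro f q
  simp only [← hA f q, Matrix.smul_apply, smul_eq_mul, Finset.mul_sum]
  exact Finset.sum_congr rfl fun p _ => by ring

theorem one : ColumnRep (1 : Matrix (Dset n k) (Dset n k) ℚ) fun f => f := by
  intro f q
  simp [Matrix.one_apply]

theorem sq (hA : ColumnRep A S) : ColumnRep (A ^ 2) fun f => S (S f) :=
  pow_two A ▸ hA.mul hA

theorem mcomm (hA : ColumnRep A S) (hB : ColumnRep B T) :
    ColumnRep (mcomm A B) fun f i j => T (S f) i j - S (T f) i j :=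
  (hA.mul hB).sub (hB.mul hA)

/-- A matrix is determined by the operator representing it. -/
theorem ext (hA : ColumnRep A S) (hB : ColumnRep B T) (h : ∀ f i j, S f i j = T f i j) :
    A = B := by
  ext ⟨⟨a, b⟩, hp⟩ q
  have key := (hA _ q).trans ((h (fun x y => if x = a ∧ y = b then 1 else 0) _ _).trans
    (hB _ q).symm)
  have hsum (M : Matrix (Dset n k) (Dset n k) ℚ) :
      ∑ p : Dset n k, (if (p.1.1 : ℚ) = a ∧ (p.1.2 : ℚ) = b then (1 : ℚ) else 0) * M p q
        = M ⟨(a, b), hp⟩ q := by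
    rw [Finset.sum_eq_single ⟨(a, b), hp⟩]
    · simp
    · rintro ⟨⟨c, d⟩, hc⟩ - hne
      rw [if_neg, zero_mul]
      rintro ⟨h1, h2⟩
      exact hne (Subtype.ext (Prod.ext (Nat.cast_injective h1) (Nat.cast_injective h2)))
    · simp
  rwa [hsum A, hsum B] at key

end ColumnRep

/-- A row vector times a column supported at the point `(x, y)`; the entry must vanish when that
point is outside the domain. -/
theorem sum_mul_ite_eq {n k : ℕ} (f : ℚ → ℚ → ℚ) {x y c : ℚ} (P : Dset n k → Prop)
    [DecidablePred P] (hP : ∀ p, P p ↔ (p.1.1 : ℚ) = x ∧ (p.1.2 : ℚ) = y)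
    (hc : c = 0 ∨ ∃ p, P p) :
    ∑ p : Dset n k, f p.1.1 p.1.2 * (if P p then c else 0) = f x y * c := by
  rcases hc with rfl | ⟨p, hp⟩
  · simp
  rw [Finset.sum_eq_single p]
  · rw [if_pos hp, ((hP p).1 hp).1, ((hP p).1 hp).2]
  · intro s _ hne
    rw [if_neg, mul_zero]
    intro hs
    obtain ⟨h1, h2⟩ := (hP p).1 hp
    obtain ⟨h3, h4⟩ := (hP s).1 hs
    exact hne (Subtype.ext (Prod.ext (Nat.cast_injective (h3.trans h1.symm))
      (Nat.cast_injective (h4.trans h2.symm))))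
  · simp

theorem columnRep_Ystar (n k : ℕ) : ColumnRep (Ystar n k) fun f i j => j * f i j := by
  intro f q
  simp [Ystar, Matrix.diagonal_apply, mul_comm]

theorem eq_neighbor_or_far (x y : ℕ) : x + 1 = y ∨ x = y ∨ x = y + 1 ∨
    x + 1 ≠ y ∧ y ≠ x + 1 ∧ x ≠ y ∧ y ≠ x ∧ x ≠ y + 1 ∧ y + 1 ≠ x := by
  omega

theorem Xop_apply_eq_sum (r n k : ℕ) (p q : Dset n k) :
    Xop r n k p q =
      (if p.1.1 = q.1.1 + 1 ∧ p.1.2 = q.1.2 then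
        ((k : ℚ) - q.1.1 - q.1.2) * ((r : ℚ) - 2) else 0)
      + (if p.1.1 = q.1.1 ∧ p.1.2 = q.1.2 then
        (q.1.1 : ℚ) * ((r : ℚ) - 3) + ((q.1.2 : ℚ) - (k : ℚ)) * ((r : ℚ) - 2) else 0)
      + (if p.1.1 + 1 = q.1.1 ∧ p.1.2 = q.1.2 then (q.1.1 : ℚ) else 0) := by
  obtain ⟨⟨a, b⟩, -⟩ := p
  obtain ⟨⟨i, j⟩, -⟩ := q
  rcases eq_neighbor_or_far a i with rfl | rfl | rfl | ha <;>
    rcases eq_neighbor_or_far b j with rfl | rfl | rfl | hb <;>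
    simp [Xop, add_assoc, -mul_eq_mul_right_iff, -mul_eq_mul_left_iff, *] <;> ring

theorem Yop_apply_eq_sum (r n k : ℕ) (p q : Dset n k) :
    Yop r n k p q =
      (if p.1.1 = q.1.1 + 1 ∧ p.1.2 = q.1.2 then
        ((k : ℚ) - q.1.1 - q.1.2) * ((r : ℚ) - 2) * q.1.2 else 0)
      + (if p.1.1 = q.1.1 ∧ p.1.2 = q.1.2 + 1 then
        ((k : ℚ) - q.1.1 - q.1.2) * ((n : ℚ) - k - q.1.2) * ((r : ℚ) - 1) else 0)
      + (if p.1.1 + 1 = q.1.1 ∧ p.1.2 = q.1.2 then (q.1.1 : ℚ) * q.1.2 else 0)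
      + (if p.1.1 = q.1.1 ∧ p.1.2 + 1 = q.1.2 then (q.1.2 : ℚ) ^ 2 else 0)
      + (if p.1.1 + 1 = q.1.1 ∧ p.1.2 = q.1.2 + 1 then
        (q.1.1 : ℚ) * ((n : ℚ) - k - q.1.2) * ((r : ℚ) - 1) else 0)
      + (if p.1.1 = q.1.1 + 1 ∧ p.1.2 + 1 = q.1.2 then
        (q.1.2 : ℚ) ^ 2 * ((r : ℚ) - 2) else 0)
      + (if p.1.1 = q.1.1 ∧ p.1.2 = q.1.2 then
        (q.1.2 : ℚ) * ((k : ℚ) - q.1.1 - q.1.2 + ((r : ℚ) - 2) * q.1.1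
          + ((n : ℚ) - k - q.1.2) * ((r : ℚ) - 1)) else 0) := by
  obtain ⟨⟨a, b⟩, -⟩ := p
  obtain ⟨⟨i, j⟩, -⟩ := q
  rcases eq_neighbor_or_far a i with rfl | rfl | rfl | ha <;>
    rcases eq_neighbor_or_far b j with rfl | rfl | rfl | hb <;>
    simp [Yop, add_assoc, -mul_eq_mul_right_iff, -mul_eq_mul_left_iff, *] <;> ring

theorem cast_eq_zero_or_one_le (m : ℕ) : (m : ℚ) = 0 ∨ 1 ≤ m := by
  rcases Nat.eq_zero_or_pos m with h | h
  · simp [h]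
  · exact Or.inr h

theorem columnRep_Xop {r n k : ℕ} :
    ColumnRep (Xop r n k) fun f i j =>
      f (i + 1) j * ((k - i - j) * (r - 2)) + f i j * (i * (r - 3) + (j - k) * (r - 2))
        + f (i - 1) j * i := by
  rintro f ⟨⟨i, j⟩, hq, hq'⟩
  simp only [Xop_apply_eq_sum]
  simp only [mul_add (f _ _), Finset.sum_add_distrib]
  dsimp only at hq hq' ⊢
  rw [← mul_add]
  have hk : (k : ℚ) - i - j = 0 ∨ i + j < k := by
    rcases hq.eq_or_lt with h | h
    · exact Or.inl (by rw [← h]; push_cast; ring)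
    · exact Or.inr h
  have hi := cast_eq_zero_or_one_le i
  congr 1; congr 1
  · refine sum_mul_ite_eq f _ (fun p => by norm_cast) ?_
    rcases hk with h | h
    · simp [h]
    · exact Or.inr ⟨⟨(i + 1, j), by omega⟩, rfl, rfl⟩
  · refine sum_mul_ite_eq f _ (fun p => by norm_cast) ?_
    exact Or.inr ⟨⟨(i, j), by omega⟩, rfl, rfl⟩
  · refine sum_mul_ite_eq f _ (fun p => by rw [eq_sub_iff_add_eq]; norm_cast) ?_
    rcases hi with h | h
    · exact Or.inl h
    · exact Or.inr ⟨⟨(i - 1, j), by omega⟩, Nat.sub_add_cancel h, rfl⟩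

theorem columnRep_Yop {r n k : ℕ} (hkn : k ≤ n) :
    ColumnRep (Yop r n k) fun f i j =>
      f (i + 1) j * ((k - i - j) * (r - 2) * j)
        + f i (j + 1) * ((k - i - j) * (n - k - j) * (r - 1))
        + f (i - 1) j * (i * j) + f i (j - 1) * j ^ 2
        + f (i - 1) (j + 1) * (i * (n - k - j) * (r - 1))
        + f (i + 1) (j - 1) * (j ^ 2 * (r - 2))
        + f i j * (j * (k - i - j + (r - 2) * i + (n - k - j) * (r - 1))) := by
  rintro f ⟨⟨i, j⟩, hq, hq'⟩
  simp only [Yop_apply_eq_sum]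
  simp only [mul_add (f _ _), Finset.sum_add_distrib]
  dsimp only at hq hq' ⊢
  have hk : (k : ℚ) - i - j = 0 ∨ i + j < k := by
    rcases hq.eq_or_lt with h | h
    · exact Or.inl (by rw [← h]; push_cast; ring)
    · exact Or.inr h
  have hn : (n : ℚ) - k - j = 0 ∨ j < n - k := by
    rcases (hq'.trans (min_le_right _ _)).eq_or_lt with h | h
    · exact Or.inl (by rw [h, Nat.cast_sub hkn]; ring)
    · exact Or.inr h
  have hi := cast_eq_zero_or_one_le i
  have hj := cast_eq_zero_or_one_le j
  congr 1; congr 1; congr 1; congr 1; congr 1; congr 1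
  · refine sum_mul_ite_eq f _ (fun p => by norm_cast) ?_
    rcases hk with h | h
    · simp [h]
    · exact Or.inr ⟨⟨(i + 1, j), by omega⟩, rfl, rfl⟩
  · refine sum_mul_ite_eq f _ (fun p => by norm_cast) ?_
    rcases hk with h | h
    · simp [h]
    rcases hn with h' | h'
    · simp [h']
    · exact Or.inr ⟨⟨(i, j + 1), by omega⟩, rfl, rfl⟩
  · refine sum_mul_ite_eq f _ (fun p => by rw [eq_sub_iff_add_eq]; norm_cast) ?_
    rcases hi with h | h
    · simp [h]
    · exact Or.inr ⟨⟨(i - 1, j), by omega⟩, Nat.sub_add_cancel h, rfl⟩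
  · refine sum_mul_ite_eq f _ (fun p => by rw [eq_sub_iff_add_eq]; norm_cast) ?_
    rcases hj with h | h
    · simp [h]
    · exact Or.inr ⟨⟨(i, j - 1), by omega⟩, rfl, Nat.sub_add_cancel h⟩
  · refine sum_mul_ite_eq f _ (fun p => by rw [eq_sub_iff_add_eq]; norm_cast) ?_
    rcases hi with h | h
    · simp [h]
    rcases hn with h' | h'
    · simp [h']
    · exact Or.inr ⟨⟨(i - 1, j + 1), by omega⟩, Nat.sub_add_cancel h, rfl⟩
  · refine sum_mul_ite_eq f _ (fun p => by rw [eq_sub_iff_add_eq]; norm_cast) ?_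
    rcases hj with h | h
    · simp [h]
    · exact Or.inr ⟨⟨(i + 1, j - 1), by omega⟩, rfl, Nat.sub_add_cancel h⟩
  · refine sum_mul_ite_eq f _ (fun p => by norm_cast) ?_
    exact Or.inr ⟨⟨(i, j), by omega⟩, rfl, rfl⟩

/-- The bispectral operators `Y`, `Y*`, `X` of the non-binary Johnson scheme satisfy the
relations of a centrally extended Hahn algebra. -/
theorem bispectral_hahn_algebra (r n k : ℕ) (hr : 3 ≤ r) (hk1 : 1 ≤ k) (hkn : k ≤ n) :
    mcomm (Ystar n k) (mcomm (Ystar n k) (Yop r n k))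
        = (-2 * (1 - (r : ℚ))) • (Ystar n k) ^ 2
          + (((n : ℚ) * (1 - (r : ℚ))) • (1 : Matrix (Dset n k) (Dset n k) ℚ) - Xop r n k)
              * Ystar n k
          + Yop r n k
  ∧ mcomm (Yop r n k) (mcomm (Ystar n k) (Yop r n k))
        = (-2 * ((r : ℚ) - 1)) • (Yop r n k * Ystar n k + Ystar n k * Yop r n k)
          + Yop r n k * (Xop r n k
              - ((n : ℚ) * (1 - (r : ℚ))) • (1 : Matrix (Dset n k) (Dset n k) ℚ))
          - (2 * ((k : ℚ) - n) * ((r : ℚ) - 1))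
              • (Xop r n k + ((k : ℚ) * ((r : ℚ) - 1)) • (1 : Matrix (Dset n k) (Dset n k) ℚ))
          - Ystar n k * ((Xop r n k) ^ 2
              + (2 * (1 - (r : ℚ)) * ((n : ℚ) - 2 * k - 1)) • Xop r n k
              + (((r : ℚ) - 1) ^ 2 * (2 * (n : ℚ) + ((n : ℚ) - 2 * k) ^ 2))
                  • (1 : Matrix (Dset n k) (Dset n k) ℚ)) := by
  have hS := columnRep_Ystar n k
  have hX := columnRep_Xop (r := r) (n := n) (k := k)
  have hY := columnRep_Yop (r := r) hkn
  constructor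
  · refine (hS.mcomm (hS.mcomm hY)).ext
      (((hS.sq.smul _).add (((ColumnRep.one.smul _).sub hX).mul hS)).add hY) fun f i j => ?_
    ring
  · refine (hY.mcomm (hS.mcomm hY)).ext
      ((((((hY.mul hS).add (hS.mul hY)).smul _).add (hY.mul (hX.sub (ColumnRep.one.smul _)))).sub
        ((hX.add (ColumnRep.one.smul _)).smul _)).sub
        (hS.mul ((hX.sq.add (hX.smul _)).add (ColumnRep.one.smul _)))) fun f i j => ?_
    simp only [sub_add_cancel, add_sub_cancel_right]
    ring
end

section
/- The first dual eigenvalues of the non-binary Johnson scheme have linear closed forms: for integers r ≥ 3 and 1 ≤ k ≤ n−1, for all x ∈ ℚ and all natural numbers y with y ≤ min(k, n−k) (and additionally y ≤ k−1 for the first identity), one has q_{10}(x,y) = (n/k)·((r−2)(k−y) − x(r−1)) and q_{01}(x,y) = (n−1)·(1 − n·y/(k(n−k))). -/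
/-- Generalized binomial coefficient `C(z, l) = z (z-1) ⋯ (z-l+1) / l!` for `z : ℚ`. -/
noncomputable def qchoose (z : ℚ) (l : ℕ) : ℚ :=
  (∏ m ∈ Finset.range l, (z - m)) / (Nat.factorial l : ℚ)

/-- Krawtchouk polynomial `K_i(x, N, p)`. -/
noncomputable def Kraw (i : ℕ) (x N p : ℚ) : ℚ :=
  ∑ l ∈ Finset.range (i + 1),
    (-1 : ℚ) ^ l * (p - 1) ^ (i - l) * qchoose x l * qchoose (N - x) (i - l)

/-- Eberlein polynomial `E_i(x, N, p)`. -/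
noncomputable def Eber (i : ℕ) (x N p : ℚ) : ℚ :=
  ∑ l ∈ Finset.range (i + 1),
    (-1 : ℚ) ^ l * qchoose x l * qchoose (p - x) (i - l) * qchoose (N - p - x) (i - l)

/-- Hahn polynomial `H_i(x, N, p) = ((C(N,i) - C(N,i-1)) / (C(p,x) C(N-p,x))) E_x(i, N, p)`,
with the convention `C(N, -1) = 0`. -/
noncomputable def Hahn (i x : ℕ) (N p : ℚ) : ℚ :=
  ((qchoose N i - if i = 0 then 0 else qchoose N (i - 1)) / (qchoose p x * qchoose (N - p) x))
    * Eber x (i : ℚ) N p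

/-- Krawtchouk polynomial with an integer index, with the convention `K_{-1} := 0`. -/
noncomputable def KrawZ (i : ℤ) (x N p : ℚ) : ℚ :=
  if i < 0 then 0 else Kraw i.toNat x N p

/-- Hahn polynomial with an integer index, with the convention `H_{-1} := 0`. -/
noncomputable def HahnZ (i : ℤ) (x : ℕ) (N p : ℚ) : ℚ :=
  if i < 0 then 0 else Hahn i.toNat x N p

/-- Dual eigenvalues `q_{ij}(x, y)` of the non-binary Johnson scheme `J_r(k, n)`,
with the convention `q_{ij} := 0` if `i < 0` or `j < 0`. -/
noncomputable def qdual (r n k : ℤ) (i j : ℤ) (x : ℚ) (y : ℕ) : ℚ :=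
  if i < 0 ∨ j < 0 then 0 else
    (qchoose (n : ℚ) i.toNat / qchoose (k : ℚ) i.toNat)
      * Kraw i.toNat x ((k : ℚ) - y) ((r : ℚ) - 1)
      * Hahn j.toNat y ((n : ℚ) - (i : ℚ)) ((k : ℚ) - (i : ℚ))

theorem qchoose_zero_right (z : ℚ) : qchoose z 0 = 1 := by simp [qchoose]

theorem qchoose_one_right (z : ℚ) : qchoose z 1 = z := by simp [qchoose]

theorem qchoose_natCast_eq_zero {m l : ℕ} (h : m < l) : qchoose m l = 0 := by
  rw [qchoose, Finset.prod_eq_zero (Finset.mem_range.2 h) (sub_self _), zero_div]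

theorem qchoose_pos {z : ℚ} {l : ℕ} (h : (l : ℚ) ≤ z) : 0 < qchoose z l := by
  refine div_pos (Finset.prod_pos fun m hm => ?_) (by positivity)
  have : (m : ℚ) < l := by exact_mod_cast Finset.mem_range.1 hm
  linarith

theorem succ_mul_qchoose_succ (z : ℚ) (l : ℕ) :
    ((l : ℚ) + 1) * qchoose z (l + 1) = z * qchoose (z - 1) l := by
  have hprod : ∏ m ∈ Finset.range l, (z - ((m + 1 : ℕ) : ℚ)) =
      ∏ m ∈ Finset.range l, (z - 1 - m) :=
    Finset.prod_congr rfl fun m _ => by push_cast; ring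
  rw [qchoose, qchoose, Finset.prod_range_succ', hprod, Nat.factorial_succ]
  have : (Nat.factorial l : ℚ) ≠ 0 := by positivity
  push_cast
  field_simp
  ring

theorem succ_mul_qchoose_succ' (z : ℚ) (l : ℕ) :
    ((l : ℚ) + 1) * qchoose z (l + 1) = (z - l) * qchoose z l := by
  rw [qchoose, qchoose, Finset.prod_range_succ, Nat.factorial_succ]
  have : (Nat.factorial l : ℚ) ≠ 0 := by positivity
  push_cast
  field_simp

theorem mul_qchoose_sub_one (z : ℚ) (l : ℕ) :
    z * qchoose (z - 1) l = (z - l) * qchoose z l := by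
  rw [← succ_mul_qchoose_succ, succ_mul_qchoose_succ']

theorem Kraw_zero (x N p : ℚ) : Kraw 0 x N p = 1 := by
  simp [Kraw, qchoose_zero_right]

theorem Kraw_one (x N p : ℚ) : Kraw 1 x N p = (p - 1) * N - p * x := by
  simp [Kraw, Finset.sum_range_succ, qchoose_zero_right, qchoose_one_right]
  ring

theorem Eber_zero_arg (i : ℕ) (N p : ℚ) :
    Eber i 0 N p = qchoose p i * qchoose (N - p) i := by
  have hvanish (l : ℕ) : qchoose 0 (l + 1) = 0 := by
    simpa using qchoose_natCast_eq_zero (m := 0) (Nat.succ_pos l)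
  simp [Eber, Finset.sum_range_succ', hvanish, qchoose_zero_right]

theorem Eber_succ_one_arg (i : ℕ) (N p : ℚ) :
    Eber (i + 1) 1 N p = qchoose (p - 1) (i + 1) * qchoose (N - p - 1) (i + 1)
      - qchoose (p - 1) i * qchoose (N - p - 1) i := by
  have hvanish (l : ℕ) : qchoose 1 (l + 1 + 1) = 0 := by
    simpa using qchoose_natCast_eq_zero (m := 1) (l := l + 1 + 1) (by omega)
  simp [Eber, Finset.sum_range_succ', hvanish, qchoose_zero_right, qchoose_one_right]
  ring

theorem mul_Eber_one_arg (i : ℕ) (N p : ℚ) :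
    p * (N - p) * Eber i 1 N p
      = (p * (N - p) - N * i) * (qchoose p i * qchoose (N - p) i) := by
  cases i with
  | zero => simp [Eber, qchoose_zero_right]
  | succ i =>
    rw [Eber_succ_one_arg]
    have h₁ := mul_qchoose_sub_one p (i + 1)
    have h₂ := mul_qchoose_sub_one (N - p) (i + 1)
    have h₃ := succ_mul_qchoose_succ p i
    have h₄ := succ_mul_qchoose_succ (N - p) i
    push_cast at *
    calc _ = (p * qchoose (p - 1) (i + 1)) * ((N - p) * qchoose (N - p - 1) (i + 1))
          - (p * qchoose (p - 1) i) * ((N - p) * qchoose (N - p - 1) i) := by ring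
      _ = _ := by rw [h₁, h₂, ← h₃, ← h₄]; ring

theorem Hahn_zero {x : ℕ} {N p : ℚ} (hp : (x : ℚ) ≤ p) (hNp : (x : ℚ) ≤ N - p) :
    Hahn 0 x N p = 1 := by
  have h₁ := (qchoose_pos hp).ne'
  have h₂ := (qchoose_pos hNp).ne'
  simp only [Hahn, if_true, Nat.cast_zero, Eber_zero_arg, qchoose_zero_right]
  field_simp
  ring

theorem Hahn_one {x : ℕ} {N p : ℚ} (hp₀ : p ≠ 0) (hNp₀ : N - p ≠ 0)
    (hp : (x : ℚ) ≤ p) (hNp : (x : ℚ) ≤ N - p) :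
    Hahn 1 x N p = (N - 1) * (1 - N * x / (p * (N - p))) := by
  have h₁ := (qchoose_pos hp).ne'
  have h₂ := (qchoose_pos hNp).ne'
  have hE : Eber x 1 N p
      = (p * (N - p) - N * x) * (qchoose p x * qchoose (N - p) x) / (p * (N - p)) := by
    rw [← mul_Eber_one_arg, mul_div_cancel_left₀ _ (mul_ne_zero hp₀ hNp₀)]
  simp only [Hahn, one_ne_zero, if_false, Nat.cast_one, hE, qchoose_one_right, Nat.sub_self,
    qchoose_zero_right]
  field_simp

/-- Linear closed forms for the first dual eigenvalues `q_{10}` and `q_{01}` of the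
non-binary Johnson scheme. -/
theorem johnson_first_dual_eigenvalues (r n k : ℤ) (hr : 3 ≤ r) (hk1 : 1 ≤ k) (hkn : k ≤ n - 1)
    (x : ℚ) (y : ℕ) (hy : (y : ℤ) ≤ min k (n - k)) :
    ((y : ℤ) ≤ k - 1 →
      qdual r n k 1 0 x y
        = ((n : ℚ) / k) * (((r : ℚ) - 2) * ((k : ℚ) - y) - x * ((r : ℚ) - 1)))
  ∧ qdual r n k 0 1 x y
      = ((n : ℚ) - 1) * (1 - (n : ℚ) * y / ((k : ℚ) * ((n : ℚ) - k))) := by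
  have hyk : (y : ℚ) ≤ k := by exact_mod_cast hy.trans (min_le_left _ _)
  have hynk : (y : ℚ) ≤ n - k := by exact_mod_cast hy.trans (min_le_right _ _)
  have hk₀ : (k : ℚ) ≠ 0 := by exact_mod_cast (by omega : k ≠ 0)
  have hnk₀ : (n : ℚ) - k ≠ 0 := by exact_mod_cast (by omega : n - k ≠ 0)
  constructor
  · intro hyk'
    have hyk₁ : (y : ℚ) ≤ k - 1 := by exact_mod_cast hyk'
    have hH : Hahn 0 y ((n : ℚ) - 1) ((k : ℚ) - 1) = 1 := Hahn_zero hyk₁ (by linarith)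
    have hK : Kraw 1 x ((k : ℚ) - y) ((r : ℚ) - 1)
        = ((r : ℚ) - 2) * ((k : ℚ) - y) - x * ((r : ℚ) - 1) := by
      rw [Kraw_one]
      ring
    simp [qdual, qchoose_one_right, hK, hH]
  · simp [qdual, qchoose_zero_right, Kraw_zero, Hahn_one hk₀ hnk₀ hyk hynk]
end
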